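/- arXiv:2507.22852 — 14 statements merged into one kernel-verified Lean document; each statement's English description precedes it below -/
import Mathlib

section
/- The optimal wage policy F* satisfies (EK) and (EB); every CDF of a wage policy satisfying (EK) and (EB) satisfies F(w) ≤ F*(w) for all w ≥ 0; consequently, F* is the unique minimizer of ∫_{w_}^∞ (1 − F(w)) dw over all CDFs of wage policies satisfying (EK) and (EB), and the support of the measure F* is exactly the interval [w_, w̄]. -/
open MeasureTheory Set Filter

noncomputable section

namespace Career

/-- Right-continuous CDF of a wage policy: `F(w) = F([0,w])`. -/
def cdf (F : Measure ℝ) (w : ℝ) : ℝ := (F (Iic w)).toReal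

/-- Left limit `F(w⁻)` of the CDF of a measure. -/
def cdfLeft (F : Measure ℝ) (w : ℝ) : ℝ := (F (Iio w)).toReal

/-- A wage policy: a Borel probability measure on `[0, ∞)`. -/
def IsWagePolicy (F : Measure ℝ) : Prop :=
  IsProbabilityMeasure F ∧ F (Iio 0) = 0

/-- An equilibrium `(σ, q)` of the game induced by the wage policy `F`:
`σ` is measurable with values in `[0,1]`, `q = ∫ σ dF`, and for every wage `w ≥ 0`
the worker works (`σ w = 1`) whenever `w + D q > λ` and shirks (`σ w = 0`)
whenever `w + D q < λ`. -/
def IsEquilibrium (D : ℝ → ℝ) (lam : ℝ) (F : Measure ℝ) (σ : ℝ → ℝ) (q : ℝ) : Prop :=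
  Measurable σ ∧ (∀ w, σ w ∈ Icc (0:ℝ) 1) ∧ q = ∫ w, σ w ∂F ∧
    ∀ w, 0 ≤ w → (lam < w + D q → σ w = 1) ∧ (w + D q < lam → σ w = 0)

/-- `q` is an equilibrium working probability of the wage policy `F`. -/
def EqWorkProb (D : ℝ → ℝ) (lam : ℝ) (F : Measure ℝ) (q : ℝ) : Prop :=
  ∃ σ : ℝ → ℝ, IsEquilibrium D lam F σ q

/-- `F` fully implements full working. -/
def FullyImplements (D : ℝ → ℝ) (lam : ℝ) (F : Measure ℝ) : Prop :=
  EqWorkProb D lam F 1 ∧ ∀ q, EqWorkProb D lam F q → q = 1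

/-- The partially optimal wage `w_ = λ - D(1)`. -/
def wLow (D : ℝ → ℝ) (lam : ℝ) : ℝ := lam - D 1

/-- The robustly optimal deterministic wage `w̄ = λ - min_{q ∈ [0,1]} D(q)`. -/
def wHigh (D : ℝ → ℝ) (lam : ℝ) : ℝ := lam - sInf (D '' Icc 0 1)

/-- `q̄(w)`: the largest `q ∈ [0,1]` with `w + D(q) = λ`. -/
def qbar (D : ℝ → ℝ) (lam : ℝ) (w : ℝ) : ℝ :=
  sSup {q | q ∈ Icc (0:ℝ) 1 ∧ w + D q = lam}

/-- The optimal wage policy `F*` (as a CDF). -/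
def Fstar (D : ℝ → ℝ) (lam : ℝ) (w : ℝ) : ℝ :=
  if w < wLow D lam then 0
  else if w < wHigh D lam then 1 - Function.rightLim (qbar D lam) w
  else 1

/-- The equilibrium-keeping constraint (EK) for a CDF `f`. -/
def EK (D : ℝ → ℝ) (lam : ℝ) (f : ℝ → ℝ) : Prop :=
  ∀ w, w < wLow D lam → f w = 0

/-- The equilibrium-breaking constraint (EB) for a CDF given as a function `f`. -/
def EBfun (D : ℝ → ℝ) (lam : ℝ) (f : ℝ → ℝ) : Prop :=
  ∀ q ∈ Ico (0:ℝ) 1, ∀ w, 0 ≤ w →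
    Function.leftLim f w ≤ 1 - q → 1 - q ≤ f w → lam ≤ w + D q

/-- The equilibrium-breaking constraint (EB) for the CDF of a measure `F`. -/
def EBmeas (D : ℝ → ℝ) (lam : ℝ) (F : Measure ℝ) : Prop :=
  ∀ q ∈ Ico (0:ℝ) 1, ∀ w, 0 ≤ w →
    cdfLeft F w ≤ 1 - q → 1 - q ≤ cdf F w → lam ≤ w + D q

end Career

namespace Career

/-- The working probabilities `q ∈ [0,1]` at which a worker paid `w` strictly prefers to shirk. -/
def shirkSet (D : ℝ → ℝ) (lam w : ℝ) : Set ℝ := {q | q ∈ Icc (0:ℝ) 1 ∧ w + D q < lam}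

variable {D : ℝ → ℝ} {lam : ℝ}

lemma bddAbove_shirkSet (w : ℝ) : BddAbove (shirkSet D lam w) :=
  ⟨1, fun _ hq => hq.1.2⟩

lemma sSup_shirkSet_nonneg (w : ℝ) : 0 ≤ sSup (shirkSet D lam w) :=
  Real.sSup_nonneg fun _ hq => hq.1.1

lemma sSup_shirkSet_le_one (w : ℝ) : sSup (shirkSet D lam w) ≤ 1 :=
  Real.sSup_le (fun _ hq => hq.1.2) zero_le_one

lemma antitone_sSup_shirkSet : Antitone fun w => sSup (shirkSet D lam w) := fun a b hab =>
  Real.sSup_le (fun _ hq => le_csSup (bddAbove_shirkSet a) ⟨hq.1, by linarith [hq.2]⟩)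
    (sSup_shirkSet_nonneg a)

lemma exists_gt_mem_shirkSet (hD : ContinuousOn D (Icc 0 1)) {q w : ℝ} (hq : q ∈ Ico (0:ℝ) 1)
    (hw : w + D q < lam) : ∃ q' ∈ shirkSet D lam w, q < q' := by
  have h1 : ∀ᶠ x in nhdsWithin q (Ioo q 1), w + D x < lam := by
    have hc : Tendsto (fun x => w + D x) (nhdsWithin q (Ioo q 1)) (nhds (w + D q)) :=
      ((hD q ⟨hq.1, hq.2.le⟩).mono fun x hx => ⟨hq.1.trans hx.1.le, hx.2.le⟩).const_add w
    exact hc.eventually_lt_const hw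
  rw [nhdsWithin_Ioo_eq_nhdsGT hq.2] at h1
  obtain ⟨x, hx, hx1⟩ := (h1.and (Ioo_mem_nhdsGT hq.2)).exists
  exact ⟨x, ⟨⟨hq.1.trans hx1.1.le, hx1.2.le⟩, hx⟩, hx1.1⟩

lemma lt_sSup_shirkSet (hD : ContinuousOn D (Icc 0 1)) {q w : ℝ} (hq : q ∈ Ico (0:ℝ) 1)
    (hw : w + D q < lam) : q < sSup (shirkSet D lam w) := by
  obtain ⟨q', hq', h⟩ := exists_gt_mem_shirkSet hD hq hw
  exact h.trans_le (le_csSup (bddAbove_shirkSet w) hq')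

lemma sSup_shirkSet_le_qbar (hD : ContinuousOn D (Icc 0 1)) {w : ℝ} (hw : wLow D lam ≤ w) :
    sSup (shirkSet D lam w) ≤ qbar D lam w := by
  refine Real.sSup_le (fun q hq => ?_) (Real.sSup_nonneg fun _ h => h.1.1)
  obtain ⟨hq01, hq⟩ := hq
  obtain ⟨x, hx, hxD⟩ := intermediate_value_Icc hq01.2
    (hD.mono (Icc_subset_Icc_left hq01.1)) (show lam - w ∈ Icc (D q) (D 1) by
      unfold wLow at hw; constructor <;> linarith)
  exact hx.1.trans (le_csSup ⟨1, fun _ h => h.1.2⟩ ⟨⟨hq01.1.trans hx.1, hx.2⟩, by linarith⟩)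

lemma qbar_le_sSup_shirkSet {w w' : ℝ} (h : w < w') :
    qbar D lam w' ≤ sSup (shirkSet D lam w) :=
  Real.sSup_le (fun _ hq => le_csSup (bddAbove_shirkSet w) ⟨hq.1, by linarith [hq.2]⟩)
    (sSup_shirkSet_nonneg w)

lemma shirkSet_nonempty (hD : ContinuousOn D (Icc 0 1)) {w : ℝ} (hw : w < wHigh D lam) :
    (shirkSet D lam w).Nonempty := by
  obtain ⟨q, hq, hqD⟩ := (isCompact_Icc.image_of_continuousOn hD).sInf_mem
    ((nonempty_Icc.2 zero_le_one).image D)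
  exact ⟨q, hq, by unfold wHigh at hw; linarith⟩

lemma shirkSet_eq_empty (hD : ContinuousOn D (Icc 0 1)) {w : ℝ} (hw : wHigh D lam ≤ w) :
    shirkSet D lam w = ∅ := by
  refine eq_empty_of_forall_notMem fun q hq => ?_
  have := csInf_le (isCompact_Icc.image_of_continuousOn hD).bddBelow (mem_image_of_mem D hq.1)
  have := hq.2
  unfold wHigh at hw
  linarith

lemma rightLim_qbar (hD : ContinuousOn D (Icc 0 1)) {w : ℝ} (hw : wLow D lam ≤ w)
    (hw' : w < wHigh D lam) :
    Function.rightLim (qbar D lam) w = sSup (shirkSet D lam w) := by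
  refine rightLim_eq_of_tendsto (tendsto_order.2 ⟨fun c hc => ?_, fun c hc => ?_⟩)
  · obtain ⟨q, hq, hcq⟩ := exists_lt_of_lt_csSup (shirkSet_nonempty hD hw') hc
    filter_upwards [Ioo_mem_nhdsGT (show w < lam - D q by linarith [hq.2])] with x hx
    exact hcq.trans_le ((le_csSup (bddAbove_shirkSet x) ⟨hq.1, by linarith [hx.2]⟩).trans
      (sSup_shirkSet_le_qbar hD (hw.trans hx.1.le)))
  · filter_upwards [self_mem_nhdsWithin] with x hx
    exact (qbar_le_sSup_shirkSet hx).trans_lt hc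

/-- The optimal policy puts mass `sup {q | w + D q < λ}` on wages above `w`. -/
lemma Fstar_eq (hD : ContinuousOn D (Icc 0 1)) (w : ℝ) :
    Fstar D lam w = 1 - sSup (shirkSet D lam w) := by
  unfold Fstar
  split_ifs with h1 h2
  · have : 1 ≤ sSup (shirkSet D lam w) :=
      le_csSup (bddAbove_shirkSet w) ⟨⟨zero_le_one, le_rfl⟩, by unfold wLow at h1; linarith⟩
    linarith [sSup_shirkSet_le_one (D := D) (lam := lam) w]
  · rw [rightLim_qbar hD (not_lt.1 h1) h2]
  · rw [shirkSet_eq_empty hD (not_lt.1 h2), Real.sSup_empty, sub_zero]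

lemma monotone_Fstar (hD : ContinuousOn D (Icc 0 1)) : Monotone (Fstar D lam) := by
  intro a b hab
  rw [Fstar_eq hD, Fstar_eq hD]
  linarith [antitone_sSup_shirkSet (D := D) (lam := lam) hab]

lemma Fstar_of_wHigh_le (hD : ContinuousOn D (Icc 0 1)) {w : ℝ} (hw : wHigh D lam ≤ w) :
    Fstar D lam w = 1 := by
  rw [Fstar_eq hD, shirkSet_eq_empty hD hw, Real.sSup_empty, sub_zero]

lemma Fstar_lt_Fstar (hD : ContinuousOn D (Icc 0 1)) {a b : ℝ} (hab : a < b)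
    (ha : a < wHigh D lam) (hb : wLow D lam < b) : Fstar D lam a < Fstar D lam b := by
  rw [Fstar_eq hD, Fstar_eq hD]
  suffices h : sSup (shirkSet D lam b) < sSup (shirkSet D lam a) by linarith
  have hK : IsCompact {q | q ∈ Icc (0:ℝ) 1 ∧ D q ≤ lam - b} :=
    isCompact_Icc.of_isClosed_subset (hD.preimage_isClosed_of_isClosed isClosed_Icc isClosed_Iic)
      fun _ h => h.1
  rcases eq_empty_or_nonempty {q | q ∈ Icc (0:ℝ) 1 ∧ D q ≤ lam - b} with he | hne
  · have hS : shirkSet D lam b = ∅ := eq_empty_of_forall_notMem fun q hq =>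
      eq_empty_iff_forall_notMem.1 he q ⟨hq.1, by linarith [hq.2]⟩
    rw [hS, Real.sSup_empty]
    obtain ⟨q, hq⟩ := shirkSet_nonempty hD ha
    rcases hq.1.1.eq_or_lt with h0 | h0
    · subst h0
      exact lt_sSup_shirkSet hD ⟨le_rfl, zero_lt_one⟩ hq.2
    · exact h0.trans_le (le_csSup (bddAbove_shirkSet a) hq)
  · obtain ⟨m, ⟨hm01, hmD⟩, hm⟩ := hK.exists_isGreatest hne
    have hm1 : m < 1 := by
      refine lt_of_le_of_ne hm01.2 ?_
      rintro rfl
      unfold wLow at hb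
      linarith
    refine lt_of_le_of_lt (Real.sSup_le (fun q hq => hm ⟨hq.1, by linarith [hq.2]⟩) hm01.1)
      (lt_sSup_shirkSet hD ⟨hm01.1, hm1⟩ (by linarith))

lemma support_Fstar (hD : ContinuousOn D (Icc 0 1)) :
    {w : ℝ | ∀ ε > 0, Fstar D lam (w - ε) < Fstar D lam (w + ε)} =
      Icc (wLow D lam) (wHigh D lam) := by
  ext w
  refine ⟨fun h => ⟨?_, ?_⟩, fun h ε hε => ?_⟩
  · by_contra! hw
    have := h ((wLow D lam - w) / 2) (by linarith)
    rw [Fstar, Fstar, if_pos (by linarith), if_pos (by linarith)] at this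
    exact this.false
  · by_contra! hw
    have := h ((w - wHigh D lam) / 2) (by linarith)
    rw [Fstar_of_wHigh_le hD (by linarith), Fstar_of_wHigh_le hD (by linarith)] at this
    exact this.false
  · exact Fstar_lt_Fstar hD (by linarith) (by linarith [h.2]) (by linarith [h.1])

lemma EK_Fstar : EK D lam (Fstar D lam) := fun _ hw => if_pos hw

lemma EBfun_Fstar (hD : ContinuousOn D (Icc 0 1)) : EBfun D lam (Fstar D lam) := by
  intro q hq w _ _ h
  by_contra! hlt
  have := lt_sSup_shirkSet hD hq hlt
  rw [Fstar_eq hD] at h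
  linarith

lemma cdf_eq_cdf (F : Measure ℝ) [IsProbabilityMeasure F] : cdf F = ProbabilityTheory.cdf F := by
  ext w
  rw [ProbabilityTheory.cdf_eq_real]
  rfl

lemma monotone_cdf (F : Measure ℝ) [IsProbabilityMeasure F] : Monotone (cdf F) :=
  cdf_eq_cdf F ▸ ProbabilityTheory.monotone_cdf F

lemma tendsto_cdf_nhdsGT (F : Measure ℝ) [IsProbabilityMeasure F] (w : ℝ) :
    Tendsto (cdf F) (nhdsWithin w (Ioi w)) (nhds (cdf F w)) := by
  rw [cdf_eq_cdf F]
  exact ((ProbabilityTheory.cdf F).right_continuous w).mono_left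
    (nhdsWithin_mono _ Ioi_subset_Ici_self)

lemma cdfLeft_le_of_forall_lt {F : Measure ℝ} [IsProbabilityMeasure F] {w c : ℝ}
    (h : ∀ x < w, cdf F x ≤ c) : cdfLeft F w ≤ c := by
  have hl : cdfLeft F w = Function.leftLim (ProbabilityTheory.cdf F) w := by
    have h0 := (ProbabilityTheory.cdf F).measure_Iio (ProbabilityTheory.tendsto_cdf_atBot F) w
    rw [ProbabilityTheory.measure_cdf, sub_zero] at h0
    rw [cdfLeft, h0, ENNReal.toReal_ofReal]
    exact (ProbabilityTheory.cdf_nonneg F (w - 1)).trans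
      ((ProbabilityTheory.monotone_cdf F).le_leftLim (by linarith))
  rw [hl, ← cdf_eq_cdf]
  exact le_of_tendsto ((monotone_cdf F).tendsto_leftLim w)
    (eventually_nhdsWithin_of_forall h)

/-- Every positive level `c` reached by the distribution function at `w` is crossed
at a quantile below `w`. -/
lemma exists_quantile {F : Measure ℝ} (hF : IsWagePolicy F) {c w : ℝ} (hc : 0 < c)
    (hcw : c ≤ cdf F w) : ∃ x, 0 ≤ x ∧ x ≤ w ∧ cdfLeft F x ≤ c ∧ c ≤ cdf F x := by
  have := hF.1
  have hb : ∀ x ∈ {x | c ≤ cdf F x}, 0 ≤ x := by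
    intro x hx
    by_contra! h0
    have h1 : F (Iic x) = 0 := measure_mono_null (fun y hy => lt_of_le_of_lt hy h0) hF.2
    have h2 : c ≤ cdf F x := hx
    rw [cdf, h1, ENNReal.toReal_zero] at h2
    linarith
  have hbdd : BddBelow {x | c ≤ cdf F x} := ⟨0, hb⟩
  have hne : {x | c ≤ cdf F x}.Nonempty := ⟨w, hcw⟩
  refine ⟨sInf {x | c ≤ cdf F x}, le_csInf hne hb, csInf_le hbdd hcw,
    cdfLeft_le_of_forall_lt fun x hx => (not_le.1 fun h => notMem_of_lt_csInf hx hbdd h).le, ?_⟩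
  refine ge_of_tendsto (tendsto_cdf_nhdsGT F _) (eventually_nhdsWithin_of_forall fun x hx => ?_)
  obtain ⟨y, hy, hyx⟩ := exists_lt_of_csInf_lt hne hx
  exact le_trans hy (monotone_cdf F hyx.le)

lemma cdf_le_Fstar (hD : ContinuousOn D (Icc 0 1)) {F : Measure ℝ} (hF : IsWagePolicy F)
    (hEK : EK D lam (cdf F)) (hEB : EBmeas D lam F) (w : ℝ) : cdf F w ≤ Fstar D lam w := by
  have := hF.1
  rcases lt_or_ge w (wLow D lam) with hw | hw
  · rw [hEK w hw, EK_Fstar w hw]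
  rw [Fstar_eq hD]
  suffices h : sSup (shirkSet D lam w) ≤ 1 - cdf F w by linarith
  refine Real.sSup_le (fun q hq => ?_)
    (sub_nonneg.2 (cdf_eq_cdf F ▸ ProbabilityTheory.cdf_le_one F w))
  by_contra! hlt
  have hq1 : q < 1 := by
    refine lt_of_le_of_ne hq.1.2 ?_
    rintro rfl
    have := hq.2
    unfold wLow at hw
    linarith
  obtain ⟨x, hx0, hxw, hl, hr⟩ := exists_quantile hF (c := 1 - q) (w := w) (by linarith)
    (by linarith)
  linarith [hEB q ⟨hq.1.1, hq1⟩ x hx0 hl hr, hq.2]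

lemma lintegral_one_sub_Fstar_ne_top (hD : ContinuousOn D (Icc 0 1)) :
    ∫⁻ w in Ioi (wLow D lam), ENNReal.ofReal (1 - Fstar D lam w) ≠ ⊤ := by
  have hle : ∀ w, ENNReal.ofReal (1 - Fstar D lam w) ≤
      (Iio (wHigh D lam)).indicator (fun _ => 1) w := by
    intro w
    rcases lt_or_ge w (wHigh D lam) with h | h
    · rw [indicator_of_mem (mem_Iio.2 h), Fstar_eq hD]
      exact ENNReal.ofReal_le_one.2 (by
        linarith [sSup_shirkSet_le_one (D := D) (lam := lam) w])
    · simp [Fstar_of_wHigh_le hD h]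
  refine ne_top_of_le_ne_top ?_ (lintegral_mono hle)
  rw [lintegral_indicator measurableSet_Iio, lintegral_const,
    Measure.restrict_restrict measurableSet_Iio, Measure.restrict_apply_univ, Iio_inter_Ioi,
    Real.volume_Ioo]
  exact ENNReal.mul_ne_top ENNReal.one_ne_top ENNReal.ofReal_ne_top

lemma cdf_eq_Fstar_of_lintegral_le (hD : ContinuousOn D (Icc 0 1)) {F : Measure ℝ}
    (hF : IsWagePolicy F) (hEK : EK D lam (cdf F)) (hEB : EBmeas D lam F)
    (h : ∫⁻ w in Ioi (wLow D lam), ENNReal.ofReal (1 - cdf F w) ≤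
      ∫⁻ w in Ioi (wLow D lam), ENNReal.ofReal (1 - Fstar D lam w)) (w : ℝ) :
    cdf F w = Fstar D lam w := by
  have := hF.1
  have hle := cdf_le_Fstar hD hF hEK hEB
  rcases lt_or_ge w (wLow D lam) with hw | hw
  · rw [hEK w hw, EK_Fstar w hw]
  have hae := ae_eq_of_ae_le_of_lintegral_le
    (ae_of_all (volume.restrict (Ioi (wLow D lam)))
      fun x => ENNReal.ofReal_le_ofReal (sub_le_sub_left (hle x) 1))
    (lintegral_one_sub_Fstar_ne_top hD)
    (measurable_const.sub (monotone_cdf F).measurable).ennreal_ofReal.aemeasurable h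
  rw [EventuallyEq, ae_restrict_iff' measurableSet_Ioi] at hae
  refine (hle w).antisymm (le_of_forall_gt_imp_ge_of_dense fun c hc => ?_)
  obtain ⟨u, hu, hsub⟩ := mem_nhdsGT_iff_exists_Ioo_subset.1
    ((tendsto_cdf_nhdsGT F w).eventually_lt_const hc)
  obtain ⟨x, hx, hxu⟩ : ∃ x, (x ∈ Ioi (wLow D lam) → ENNReal.ofReal (1 - Fstar D lam x) =
      ENNReal.ofReal (1 - cdf F x)) ∧ x ∈ Ioo w u := by
    have hpos : volume (Ioo w u) ≠ 0 := by
      simpa [Real.volume_Ioo] using hu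
    exact (Frequently.and_eventually (frequently_ae_mem_iff.2 hpos) hae).exists.imp
      fun _ hy => hy.symm
  have heq := hx (hw.trans_lt hxu.1)
  rw [ENNReal.ofReal_eq_ofReal_iff
    (by rw [Fstar_eq hD]; linarith [sSup_shirkSet_nonneg (D := D) (lam := lam) x])
    (sub_nonneg.2 (cdf_eq_cdf F ▸ ProbabilityTheory.cdf_le_one F x))] at heq
  have hlt : cdf F x < c := hsub hxu
  linarith [monotone_Fstar (lam := lam) hD hxu.1.le]

end Career

open Career in
/-- `F*` satisfies (EK) and (EB); every CDF of a wage policy satisfying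
(EK) and (EB) is pointwise below `F*`; consequently `F*` is the unique minimizer of
`∫_{w_}^∞ (1 − F(w)) dw` over such CDFs, and the support of the measure `F*` is
exactly `[w_, w̄]`. -/
theorem statement0 (D : ℝ → ℝ) (lam : ℝ)
    (hD : ContinuousOn D (Icc 0 1))
    (hlam : ∀ q ∈ Icc (0:ℝ) 1, D q < lam) :
    (EK D lam (Fstar D lam) ∧ EBfun D lam (Fstar D lam)) ∧
    (∀ F : Measure ℝ, IsWagePolicy F → EK D lam (cdf F) → EBmeas D lam F →
      ∀ w, 0 ≤ w → cdf F w ≤ Fstar D lam w) ∧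
    (∀ F : Measure ℝ, IsWagePolicy F → EK D lam (cdf F) → EBmeas D lam F →
      (∫⁻ w in Ioi (wLow D lam), ENNReal.ofReal (1 - Fstar D lam w)) ≤
        ∫⁻ w in Ioi (wLow D lam), ENNReal.ofReal (1 - cdf F w)) ∧
    (∀ F : Measure ℝ, IsWagePolicy F → EK D lam (cdf F) → EBmeas D lam F →
      (∫⁻ w in Ioi (wLow D lam), ENNReal.ofReal (1 - cdf F w)) =
        (∫⁻ w in Ioi (wLow D lam), ENNReal.ofReal (1 - Fstar D lam w)) →
      ∀ w, cdf F w = Fstar D lam w) ∧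
    ({w : ℝ | ∀ ε > 0, Fstar D lam (w - ε) < Fstar D lam (w + ε)} =
      Icc (wLow D lam) (wHigh D lam)) := by
  have hle := fun F hF hEK hEB => cdf_le_Fstar (F := F) (lam := lam) hD hF hEK hEB
  refine ⟨⟨EK_Fstar, EBfun_Fstar hD⟩, fun F hF hEK hEB w _ => hle F hF hEK hEB w,
    fun F hF hEK hEB => lintegral_mono fun w =>
      ENNReal.ofReal_le_ofReal (sub_le_sub_left (hle F hF hEK hEB w) 1),
    fun F hF hEK hEB h => cdf_eq_Fstar_of_lintegral_le hD hF hEK hEB h.le, support_Fstar hD⟩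
end
end

section
/- Assume w_ < w̄. Then q̄(w_) = 1, 0 < q̄(w) < 1 for every w ∈ (w_, w̄), and q̄ is strictly decreasing on [w_, w̄): for all w₁, w₂ with w_ ≤ w₁ < w₂ < w̄ one has q̄(w₂) < q̄(w₁). -/
open MeasureTheory Set Filter

noncomputable section

namespace Career

theorem lt_qbar {D : ℝ → ℝ} {lam w q : ℝ} (hD : ContinuousOn D (Icc 0 1))
    (hq : q ∈ Icc (0:ℝ) 1) (hqw : D q < lam - w) (hw : wLow D lam ≤ w) :
    q < qbar D lam w := by
  unfold wLow at hw
  obtain ⟨x, hx, hDx⟩ := intermediate_value_Ioc hq.2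
    (hD.mono (Icc_subset_Icc_left hq.1)) (show lam - w ∈ Ioc (D q) (D 1) from ⟨hqw, by linarith⟩)
  refine hx.1.trans_le (le_csSup ⟨1, fun y hy => hy.1.2⟩ ⟨⟨hq.1.trans hx.1.le, hx.2⟩, ?_⟩)
  linarith

theorem exists_lt_sub_of_lt_wHigh {D : ℝ → ℝ} {lam w : ℝ} (hw : w < wHigh D lam) :
    ∃ q ∈ Icc (0:ℝ) 1, D q < lam - w := by
  unfold wHigh at hw
  obtain ⟨_, ⟨q, hq, rfl⟩, hlt⟩ := exists_lt_of_csInf_lt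
    ((nonempty_Icc.2 zero_le_one).image D) (show sInf (D '' Icc 0 1) < lam - w by linarith)
  exact ⟨q, hq, hlt⟩

theorem qbar_mem {D : ℝ → ℝ} {lam w : ℝ} (hD : ContinuousOn D (Icc 0 1))
    (hw : wLow D lam ≤ w) (hw' : w < wHigh D lam) :
    qbar D lam w ∈ {q | q ∈ Icc (0:ℝ) 1 ∧ w + D q = lam} := by
  obtain ⟨q, hq, hqw⟩ := exists_lt_sub_of_lt_wHigh hw'
  unfold wLow at hw
  obtain ⟨x, hx, hDx⟩ := intermediate_value_Icc hq.2
    (hD.mono (Icc_subset_Icc_left hq.1))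
    (show lam - w ∈ Icc (D q) (D 1) from ⟨hqw.le, by linarith⟩)
  have hclosed : IsClosed {q | q ∈ Icc (0:ℝ) 1 ∧ w + D q = lam} :=
    (continuousOn_const.add hD).preimage_isClosed_of_isClosed isClosed_Icc
      (isClosed_singleton (x := lam))
  exact hclosed.csSup_mem ⟨x, ⟨hq.1.trans hx.1, hx.2⟩, by linarith⟩ ⟨1, fun y hy => hy.1.2⟩

end Career

open Career in
/-- Assume `w_ < w̄`. Then `q̄(w_) = 1`, `0 < q̄(w) < 1` on `(w_, w̄)`,
and `q̄` is strictly decreasing on `[w_, w̄)`. -/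
theorem statement2 (D : ℝ → ℝ) (lam : ℝ)
    (hD : ContinuousOn D (Icc 0 1))
    (hlam : ∀ q ∈ Icc (0:ℝ) 1, D q < lam)
    (hlt : wLow D lam < wHigh D lam) :
    qbar D lam (wLow D lam) = 1 ∧
    (∀ w ∈ Ioo (wLow D lam) (wHigh D lam), 0 < qbar D lam w ∧ qbar D lam w < 1) ∧
    (∀ w₁ w₂, wLow D lam ≤ w₁ → w₁ < w₂ → w₂ < wHigh D lam →
      qbar D lam w₂ < qbar D lam w₁) := by
  refine ⟨?_, fun w hw => ⟨?_, ?_⟩, fun w₁ w₂ h₁ h₁₂ h₂ => ?_⟩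
  · refine le_antisymm (qbar_mem hD le_rfl hlt).1.2
      (le_csSup ⟨1, fun y hy => hy.1.2⟩ ⟨right_mem_Icc.2 zero_le_one, ?_⟩)
    unfold wLow
    ring
  · obtain ⟨q, hq, hqw⟩ := exists_lt_sub_of_lt_wHigh hw.2
    exact hq.1.trans_lt (lt_qbar hD hq hqw hw.1.le)
  · obtain ⟨hmem, heq⟩ := qbar_mem hD hw.1.le hw.2
    refine lt_of_le_of_ne hmem.2 fun h => ?_
    rw [h] at heq
    have := hw.1
    unfold wLow at this
    linarith
  · obtain ⟨hmem, heq⟩ := qbar_mem hD (h₁.trans h₁₂.le) h₂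
    exact lt_qbar hD hmem (by linarith) h₁
end
end

section
/- If a wage policy F fully implements full working, then F satisfies (EK), i.e. F(w) = 0 for all w < w_, and F satisfies (EB), i.e. for every q ∈ [0,1) and every w ≥ 0 with F(w⁻) ≤ 1 − q ≤ F(w), one has w + D(q) ≥ λ. -/
open MeasureTheory Set Filter

noncomputable section

/-- If the sets `U x` form an open family, their measure is lower semicontinuous in `x`. -/
theorem lowerSemicontinuous_measureReal_of_isOpen {X : Type*} [TopologicalSpace X]
    (F : Measure ℝ) [IsFiniteMeasure F] {U : X → Set ℝ}
    (hU : IsOpen {p : X × ℝ | p.2 ∈ U p.1}) :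
    LowerSemicontinuous fun x => F.real (U x) := by
  intro x y hy
  rcases lt_or_ge y 0 with hy0 | hy0
  · exact Eventually.of_forall fun _ => hy0.trans_le measureReal_nonneg
  have hUx : IsOpen (U x) := hU.preimage (by fun_prop : Continuous fun w : ℝ => (x, w))
  have hlt : ENNReal.ofReal y < F (U x) :=
    (ENNReal.ofReal_lt_iff_lt_toReal hy0 (measure_ne_top F _)).2 hy
  obtain ⟨K, hKU, hK, hyK⟩ := hUx.exists_lt_isCompact hlt
  have hev : ∀ᶠ x' in nhds x, ∀ w ∈ K, w ∈ U x' :=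
    hK.eventually_forall_of_forall_eventually fun w hw => hU.mem_nhds (hKU hw)
  filter_upwards [hev] with x' hx'
  exact (ENNReal.ofReal_lt_iff_lt_toReal hy0 (measure_ne_top F _)).1
    (hyK.trans_le (measure_mono hx'))

/-- The masses of the wages above, below and at the indifference wage add up to one. -/
theorem measureReal_gt_add_lt_add_eq (F : Measure ℝ) [IsProbabilityMeasure F] (lam d : ℝ) :
    F.real {w | lam < w + d} + F.real {w | w + d < lam} + F.real {w | w + d = lam} = 1 := by
  have hlt : MeasurableSet {w : ℝ | w + d < lam} := measurableSet_lt (by fun_prop) (by fun_prop)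
  have heq : MeasurableSet {w : ℝ | w + d = lam} := measurableSet_eq_fun (by fun_prop) (by fun_prop)
  rw [← measureReal_union _ hlt, ← measureReal_union _ heq, ← probReal_univ (μ := F)]
  · congr 1
    ext w
    simp only [mem_union, mem_ofPred_eq, mem_univ, iff_true]
    rcases lt_trichotomy lam (w + d) with h | h | h <;> simp [h]
  · refine Set.disjoint_left.2 ?_
    rintro w (h | h) (h' : w + d = lam)
    · exact h.ne' h'
    · exact h.ne h'
  · exact Set.disjoint_left.2 fun w (h : lam < w + d) (h' : w + d < lam) => lt_asymm h h'

open Career in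
/-- `q` is an equilibrium working probability as soon as it lies between the mass of the workers
who strictly prefer to work and that of the workers who weakly prefer to work. -/
theorem eqWorkProb_of_le_of_le {D : ℝ → ℝ} {lam : ℝ} {F : Measure ℝ} [IsProbabilityMeasure F]
    {q : ℝ} (hgt : F.real {w | lam < w + D q} ≤ q) (hlt : F.real {w | w + D q < lam} ≤ 1 - q) :
    EqWorkProb D lam F q := by
  have hsum := measureReal_gt_add_lt_add_eq F lam (D q)
  set P := {w | lam < w + D q} with hP
  set E := {w | w + D q = lam} with hE
  have hPm : MeasurableSet P := measurableSet_lt (by fun_prop) (by fun_prop)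
  have hEm : MeasurableSet E := measurableSet_eq_fun (by fun_prop) (by fun_prop)
  obtain ⟨c, hc0, hc1, hc⟩ : ∃ c : ℝ, 0 ≤ c ∧ c ≤ 1 ∧ F.real E * c = q - F.real P := by
    rcases (measureReal_nonneg : 0 ≤ F.real E).eq_or_lt with h | h
    · exact ⟨0, le_rfl, zero_le_one, by linarith⟩
    · exact ⟨(q - F.real P) / F.real E, div_nonneg (by linarith) h.le,
        (div_le_one h).2 (by linarith), by field_simp⟩
  refine ⟨fun w => P.indicator (fun _ => 1) w + E.indicator (fun _ => c) w,
    (measurable_const.indicator hPm).add (measurable_const.indicator hEm), fun w => ?_, ?_,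
    fun w _ => ⟨fun h => ?_, fun h => ?_⟩⟩
  · rcases lt_trichotomy lam (w + D q) with h | h | h
    · simp [hP, hE, h, h.ne']
    · simp [hP, hE, ← h, hc0, hc1]
    · simp [hP, hE, h.ne, h.not_gt]
  · rw [integral_add ((integrable_const _).indicator hPm) ((integrable_const _).indicator hEm),
      integral_indicator_const _ hPm, integral_indicator_const _ hEm]
    simp only [smul_eq_mul]
    linarith
  · simp [hP, hE, h, h.ne']
  · simp [hP, hE, h.ne, h.not_gt]

open Career in
/-- If at most a fraction `q₀` of the workers strictly prefers to work at `q₀`, then some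
equilibrium working probability lies in `[0, q₀]`. -/
theorem exists_eqWorkProb_le {D : ℝ → ℝ} {lam q₀ : ℝ} {F : Measure ℝ} [IsProbabilityMeasure F]
    (hq₀ : 0 ≤ q₀) (hD : ContinuousOn D (Icc 0 q₀)) (hgt : F.real {w | lam < w + D q₀} ≤ q₀) :
    ∃ q ≤ q₀, EqWorkProb D lam F q := by
  have hDc : Continuous fun x : Icc 0 q₀ => D x := hD.domRestrict
  have hDp : Continuous fun p : Icc 0 q₀ × ℝ => p.2 + D p.1 :=
    continuous_snd.add (hDc.comp continuous_fst)
  have hA : IsClosed {x : Icc 0 q₀ | F.real {w | w + D x < lam} + x ≤ 1} :=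
    ((lowerSemicontinuous_measureReal_of_isOpen F (U := fun x : Icc 0 q₀ => {w | w + D x < lam})
      (isOpen_lt hDp continuous_const)).add
        continuous_subtype_val.lowerSemicontinuous).isClosed_preimage 1
  have hB : IsClosed {x : Icc 0 q₀ | F.real {w | lam < w + D x} + -x ≤ 0} :=
    ((lowerSemicontinuous_measureReal_of_isOpen F (U := fun x : Icc 0 q₀ => {w | lam < w + D x})
      (isOpen_lt continuous_const hDp)).add
        continuous_subtype_val.neg.lowerSemicontinuous).isClosed_preimage 0
  have : PreconnectedSpace (Icc 0 q₀) := Subtype.preconnectedSpace isPreconnected_Icc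
  obtain ⟨x, -, hxA, hxB⟩ := isPreconnected_closed_iff.1
    (isPreconnected_univ (α := Icc 0 q₀)) _ _ hA hB
    (fun x _ => by
      have hsum := measureReal_gt_add_lt_add_eq F lam (D x)
      have hE : 0 ≤ F.real {w | w + D x = lam} := measureReal_nonneg
      rcases le_total (F.real {w | lam < w + D x}) x with h | h
      · exact Or.inr (by simpa using h)
      · exact Or.inl (by simp only [mem_ofPred_eq]; linarith))
    ⟨⟨0, le_rfl, hq₀⟩, mem_univ _, by simp⟩
    ⟨⟨q₀, hq₀, le_rfl⟩, mem_univ _, by simpa using hgt⟩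
  simp only [mem_ofPred_eq] at hxA hxB
  exact ⟨x, x.2.2, eqWorkProb_of_le_of_le (by linarith) (by linarith)⟩

open Career in
/-- If full working is an equilibrium, no mass lies on wages below `λ - D 1`. -/
theorem ek_of_eqWorkProb_one {D : ℝ → ℝ} {lam : ℝ} {F : Measure ℝ} (hF : IsWagePolicy F)
    (h : EqWorkProb D lam F 1) : EK D lam (cdf F) := by
  obtain ⟨σ, hσm, hσ, hint, hopt⟩ := h
  have := hF.1
  intro w hw
  have hσi : Integrable σ F := Integrable.of_mem_Icc 0 1 hσm.aemeasurable (ae_of_all _ hσ)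
  have hone : (fun w => 1 - σ w) =ᵐ[F] 0 := by
    refine (integral_eq_zero_iff_of_nonneg (fun w => sub_nonneg.2 (hσ w).2)
      ((integrable_const 1).sub hσi)).1 ?_
    rw [integral_sub (integrable_const 1) hσi, ← hint]
    simp
  have hnn : ∀ᵐ v ∂F, v ∉ Iio (0 : ℝ) := measure_eq_zero_iff_ae_notMem.1 hF.2
  have hzero : F (Iic w) = 0 := by
    refine measure_eq_zero_iff_ae_notMem.2 ?_
    filter_upwards [hone, hnn] with v hv hv0 hvw
    have hlt : v + D 1 < lam := by
      simp only [wLow, mem_Iic] at hw hvw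
      linarith
    have := (hopt v (not_lt.1 hv0)).2 hlt
    simp [this] at hv
  simp [cdf, hzero]

open Career in
/-- If a wage policy `F` fully implements full working, then its CDF
satisfies (EK) and (EB). -/
theorem statement3 (D : ℝ → ℝ) (lam : ℝ)
    (hD : ContinuousOn D (Icc 0 1))
    (hlam : ∀ q ∈ Icc (0:ℝ) 1, D q < lam)
    (F : Measure ℝ) (hF : IsWagePolicy F)
    (hFI : FullyImplements D lam F) :
    EK D lam (cdf F) ∧ EBmeas D lam F := by
  have := hF.1
  refine ⟨ek_of_eqWorkProb_one hF hFI.1, fun q hq w _ _ hqw => ?_⟩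
  by_contra! hlt
  have hgt : F.real {v | lam < v + D q} ≤ q := by
    have hsub : {v | lam < v + D q} ⊆ (Iic w)ᶜ := fun v (hv : lam < v + D q) =>
      not_le.2 (by linarith : w < v)
    have hcompl := probReal_compl_eq_one_sub (μ := F) (measurableSet_Iic (a := w))
    have hcdf : F.real (Iic w) = cdf F w := rfl
    linarith [measureReal_mono (μ := F) hsub]
  obtain ⟨q', hq', heq⟩ :=
    exists_eqWorkProb_le hq.1 (hD.mono (Icc_subset_Icc_right hq.2.le)) hgt
  linarith [hFI.2 q' heq, hq.2]
end
end

section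
/- Assume w_ < w̄. Let F be the CDF of an atomless wage policy such that F(w) = 0 for all w ≤ w_ and 1 − F(w) > q̄(w) for all w ∈ (w_, w̄]. Then F fully implements full working. -/
open MeasureTheory Set Filter

noncomputable section

namespace Career

/-- Under an atomless policy, every equilibrium working probability equals the mass of the wages
above the cutoff `λ - D q`. -/
lemma EqWorkProb.eq_one_sub_cdf {D : ℝ → ℝ} {lam q : ℝ} {F : Measure ℝ} (hF : IsWagePolicy F)
    (hatomless : ∀ x : ℝ, F {x} = 0) (hq : EqWorkProb D lam F q) :
    q = 1 - cdf F (lam - D q) := by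
  have := hF.1
  obtain ⟨σ, -, -, hint, hσ⟩ := hq
  have hne : ∀ᵐ x ∂F, x ≠ lam - D q := measure_eq_zero_iff_ae_notMem.1 (hatomless _)
  have hnonneg : ∀ᵐ x ∂F, x ∉ Iio (0 : ℝ) := measure_eq_zero_iff_ae_notMem.1 hF.2
  have hae : σ =ᵐ[F] (Iic (lam - D q))ᶜ.indicator 1 := by
    filter_upwards [hne, hnonneg] with x hx hx0
    have hx0 : 0 ≤ x := not_lt.1 hx0
    rcases lt_or_gt_of_ne hx with h | h
    · rw [(hσ x hx0).2 (by linarith), indicator_of_notMem (by simpa using h.le)]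
    · rw [(hσ x hx0).1 (by linarith), indicator_of_mem (by simpa using h), Pi.one_apply]
  calc q = ∫ x, σ x ∂F := hint
    _ = ∫ x, (Iic (lam - D q))ᶜ.indicator 1 x ∂F := integral_congr_ae hae
    _ = 1 - cdf F (lam - D q) := by
      rw [integral_indicator_one measurableSet_Iic.compl, probReal_compl_eq_one_sub measurableSet_Iic]
      rfl

/-- An equilibrium working probability lies in the unit interval. -/
lemma EqWorkProb.mem_Icc {D : ℝ → ℝ} {lam q : ℝ} {F : Measure ℝ} [IsProbabilityMeasure F]
    (hq : EqWorkProb D lam F q) : q ∈ Icc (0 : ℝ) 1 := by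
  obtain ⟨σ, -, hσ, rfl, -⟩ := hq
  refine ⟨integral_nonneg fun x => (hσ x).1, ?_⟩
  have h := integral_mono_of_nonneg (ae_of_all F fun x => (hσ x).1)
    (integrable_const (1 : ℝ)) (ae_of_all F fun x => (hσ x).2)
  simpa using h

/-- Full working is an equilibrium outcome if almost no wage is below `w_`. -/
lemma eqWorkProb_one {D : ℝ → ℝ} {lam : ℝ} {F : Measure ℝ} [IsProbabilityMeasure F]
    (hEK : cdf F (wLow D lam) = 0) : EqWorkProb D lam F 1 := by
  have hnull : F (Iic (wLow D lam)) = 0 :=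
    ((ENNReal.toReal_eq_zero_iff _).1 hEK).resolve_right (measure_ne_top _ _)
  have hae : (Ici (wLow D lam)).indicator (1 : ℝ → ℝ) =ᵐ[F] fun _ => 1 := by
    filter_upwards [measure_eq_zero_iff_ae_notMem.1 hnull] with x hx
    exact indicator_of_mem (not_le.1 hx).le _
  refine ⟨(Ici (wLow D lam)).indicator 1, measurable_one.indicator measurableSet_Ici,
    fun w => ⟨indicator_nonneg (fun _ _ => zero_le_one) w,
      indicator_le_self' (fun _ _ => zero_le_one) w⟩, ?_, fun w _ => ⟨fun h => ?_, fun h => ?_⟩⟩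
  · rw [integral_congr_ae hae]
    simp
  · exact indicator_of_mem (mem_Ici.2 (by unfold wLow; linarith)) _
  · exact indicator_of_notMem (fun hw => by rw [mem_Ici, wLow] at hw; linarith) _

end Career

open Career in
/-- Assume `w_ < w̄`. If `F` is an atomless wage policy with
`F(w) = 0` for all `w ≤ w_` and `1 − F(w) > q̄(w)` for all `w ∈ (w_, w̄]`, then `F`
fully implements full working. -/
theorem statement4 (D : ℝ → ℝ) (lam : ℝ)
    (hD : ContinuousOn D (Icc 0 1))
    (hlam : ∀ q ∈ Icc (0:ℝ) 1, D q < lam)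
    (hlt : wLow D lam < wHigh D lam)
    (F : Measure ℝ) (hF : IsWagePolicy F)
    (hatomless : ∀ x : ℝ, F {x} = 0)
    (hEK : ∀ w, w ≤ wLow D lam → cdf F w = 0)
    (habove : ∀ w ∈ Ioc (wLow D lam) (wHigh D lam), qbar D lam w < 1 - cdf F w) :
    FullyImplements D lam F := by
  have := hF.1
  refine ⟨eqWorkProb_one (hEK _ le_rfl), fun q hq => ?_⟩
  have hmem := hq.mem_Icc
  have heq := hq.eq_one_sub_cdf hF hatomless
  rcases le_or_gt (lam - D q) (wLow D lam) with hw | hw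
  · rwa [hEK _ hw, sub_zero] at heq
  have hle : lam - D q ≤ wHigh D lam :=
    sub_le_sub_left (csInf_le (isCompact_Icc.image_of_continuousOn hD).bddBelow
      (mem_image_of_mem D hmem)) lam
  have hqbar : q ≤ qbar D lam (lam - D q) :=
    le_csSup ⟨1, fun _ hx => hx.1.2⟩ ⟨hmem, sub_add_cancel lam (D q)⟩
  exact absurd (habove _ ⟨hw, hle⟩) (by linarith)
end
end

section
/- A wage policy F admits an equilibrium with working probability q = 1 if and only if F(w) = 0 for every w < w_ (equivalently, F assigns measure zero to [0, w_)). Consequently, among all wage policies admitting an equilibrium with q = 1, the expected wage ∫ w dF(w) is at least w_ = λ − D(1), with equality if and only if F = δ_{w_}. -/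
open MeasureTheory Set Filter

noncomputable section

namespace Career

/-- Almost every point is at least `a` iff the measure of `(-∞, a)` is zero. -/
lemma ae_const_le_iff {F : Measure ℝ} {a : ℝ} : (∀ᵐ w ∂F, a ≤ w) ↔ F (Iio a) = 0 := by
  simp only [ae_iff, not_le, Iio_def]

/-- Under an equilibrium with `q = 1`, almost every wage is at least `wLow`. -/
lemma EqWorkProb.measure_Iio_wLow {D : ℝ → ℝ} {lam : ℝ} {F : Measure ℝ}
    (hF : IsWagePolicy F) (h : EqWorkProb D lam F 1) : F (Iio (wLow D lam)) = 0 := by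
  obtain ⟨hprob, hneg⟩ := hF
  obtain ⟨σ, hmeas, hIcc, hint, hσ⟩ := h
  have hintσ : Integrable σ F :=
    Integrable.of_mem_Icc 0 1 hmeas.aemeasurable (Eventually.of_forall hIcc)
  have hae : (fun w => 1 - σ w) =ᵐ[F] 0 := by
    rw [← integral_eq_zero_iff_of_nonneg (fun w => sub_nonneg.2 (hIcc w).2)
      ((integrable_const 1).sub hintσ), integral_sub (integrable_const 1) hintσ, ← hint]
    simp
  have hnn : ∀ᵐ w ∂F, 0 ≤ w := ae_const_le_iff.2 hneg
  rw [← ae_const_le_iff]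
  filter_upwards [hae, hnn] with w hw hw0
  by_contra! hlt
  have h0 := (hσ w hw0).2 (by unfold wLow at hlt; linarith)
  simp [h0] at hw

/-- If almost every wage is at least `wLow`, working exactly at the wages `w ≥ wLow` is an
equilibrium with `q = 1`. -/
lemma eqWorkProb_one_of_measure_Iio {D : ℝ → ℝ} {lam : ℝ} {F : Measure ℝ}
    [IsProbabilityMeasure F] (h : F (Iio (wLow D lam)) = 0) : EqWorkProb D lam F 1 := by
  refine ⟨(Ici (wLow D lam)).indicator 1, measurable_one.indicator measurableSet_Ici,
    fun w => ?_, ?_, fun w _ => ⟨fun hw => ?_, fun hw => ?_⟩⟩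
  · by_cases hw : w ∈ Ici (wLow D lam) <;> simp [hw]
  · rw [integral_indicator_one measurableSet_Ici, measureReal_def,
      (prob_compl_eq_zero_iff measurableSet_Ici).1 (by rwa [compl_Ici]), ENNReal.toReal_one]
  · refine indicator_of_mem ?_ _
    simp only [wLow, mem_Ici]
    linarith
  · refine indicator_of_notMem ?_ _
    simp only [wLow, mem_Ici, not_le]
    linarith

/-- The CDF vanishes strictly below `a` iff the measure of `(-∞, a)` is zero. -/
lemma forall_cdf_eq_zero_iff {F : Measure ℝ} [IsFiniteMeasure F] {a : ℝ} :
    (∀ w, w < a → cdf F w = 0) ↔ F (Iio a) = 0 := by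
  refine ⟨fun h => ?_, fun h w hw => ?_⟩
  · obtain ⟨u, -, hlt, hu⟩ := exists_seq_strictMono_tendsto a
    rw [← iUnion_Iic_eq_Iio_of_lt_of_tendsto hlt hu]
    refine measure_iUnion_null fun n => ?_
    simpa [cdf, ENNReal.toReal_eq_zero_iff] using h (u n) (hlt n)
  · simp [cdf, measure_mono_null (Iic_subset_Iio.2 hw) h]

/-- A probability measure concentrated at a point is the point mass there. -/
lemma eq_dirac_of_ae_eq {F : Measure ℝ} [IsProbabilityMeasure F] {a : ℝ}
    (h : ∀ᵐ w ∂F, w = a) : F = Measure.dirac a := by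
  have hmap : F.map id = F.map (fun _ => a) := Measure.map_congr h
  simpa [Measure.map_id, Measure.map_const] using hmap

end Career

open Career in
/-- A wage policy admits an equilibrium with working probability `q = 1`
iff its CDF vanishes below `w_` (equivalently, it assigns measure zero to `[0, w_)`).
Consequently, among wage policies admitting an equilibrium with `q = 1`, the expected
wage is at least `w_ = λ − D(1)`, with equality iff `F = δ_{w_}`. -/
theorem statement5 (D : ℝ → ℝ) (lam : ℝ)
    (hD : ContinuousOn D (Icc 0 1))
    (hlam : ∀ q ∈ Icc (0:ℝ) 1, D q < lam) :
    (∀ F : Measure ℝ, IsWagePolicy F →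
      ((EqWorkProb D lam F 1 ↔ ∀ w, w < wLow D lam → cdf F w = 0) ∧
       (EqWorkProb D lam F 1 ↔ F (Iio (wLow D lam)) = 0))) ∧
    (∀ F : Measure ℝ, IsWagePolicy F → EqWorkProb D lam F 1 →
      (ENNReal.ofReal (wLow D lam) ≤ ∫⁻ w, ENNReal.ofReal w ∂F) ∧
      ((∫⁻ w, ENNReal.ofReal w ∂F) = ENNReal.ofReal (wLow D lam) ↔
        F = Measure.dirac (wLow D lam))) := by
  have hpos : 0 < wLow D lam := sub_pos.2 (hlam 1 (right_mem_Icc.2 zero_le_one))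
  have hiff : ∀ F : Measure ℝ, IsWagePolicy F →
      (EqWorkProb D lam F 1 ↔ F (Iio (wLow D lam)) = 0) := fun F hF =>
    have := hF.1
    ⟨fun h => h.measure_Iio_wLow hF, eqWorkProb_one_of_measure_Iio⟩
  refine ⟨fun F hF => ⟨?_, hiff F hF⟩, fun F hF hE => ?_⟩
  · have := hF.1
    rw [hiff F hF, forall_cdf_eq_zero_iff]
  · have := hF.1
    have hge : ∀ᵐ w ∂F, wLow D lam ≤ w :=
      ae_const_le_iff.2 (hE.measure_Iio_wLow hF)
    have hle : (fun _ => ENNReal.ofReal (wLow D lam)) ≤ᵐ[F] fun w => ENNReal.ofReal w := by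
      filter_upwards [hge] with w hw using ENNReal.ofReal_le_ofReal hw
    refine ⟨by simpa using lintegral_mono_ae hle, fun h => ?_, fun h => ?_⟩
    · have hae := ae_eq_of_ae_le_of_lintegral_le hle (by simp)
        ENNReal.measurable_ofReal.aemeasurable (by simp [h])
      refine eq_dirac_of_ae_eq ?_
      filter_upwards [hae, hge] with w hw hw'
      exact ((ENNReal.ofReal_eq_ofReal_iff hpos.le (hpos.le.trans hw')).1 hw).symm
    · rw [h, lintegral_dirac]
end
end

section
/- For w ≥ 0, the point mass δ_w fully implements full working if and only if w ≥ w_, w > λ − D(0), and w ≠ λ − D(q) for every q ∈ [0,1). Moreover, inf{w ≥ 0 : δ_w fully implements full working} = w̄, and this infimum is attained if and only if D(q) > D(1) for every q ∈ [0,1). -/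
open MeasureTheory Set Filter

noncomputable section

namespace Career

lemma eqWorkProb_dirac_iff {D : ℝ → ℝ} {lam w q : ℝ} (hw : 0 ≤ w) :
    EqWorkProb D lam (Measure.dirac w) q ↔
      q ∈ Icc (0:ℝ) 1 ∧ (lam < w + D q → q = 1) ∧ (w + D q < lam → q = 0) := by
  constructor
  · rintro ⟨σ, -, h01, hq, h⟩
    rw [integral_dirac] at hq
    rw [hq] at h ⊢
    exact ⟨h01 w, h w hw⟩
  · rintro ⟨hq, h1, h0⟩
    refine ⟨fun x => if x = w then q else if lam ≤ x + D q then 1 else 0, ?_, ?_, ?_, ?_⟩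
    · refine Measurable.ite (measurableSet_singleton w) measurable_const
        (Measurable.ite ?_ measurable_const measurable_const)
      exact measurableSet_le measurable_const (measurable_id.add_const _)
    · intro x
      dsimp only
      split_ifs
      · exact hq
      · simp
      · simp
    · rw [integral_dirac]
      simp
    · intro x _
      dsimp only
      by_cases hx : x = w
      · subst hx
        simpa using ⟨h1, h0⟩
      · simp only [if_neg hx]
        exact ⟨fun h => if_pos h.le, fun h => if_neg h.not_ge⟩

lemma fullyImplements_dirac_iff {D : ℝ → ℝ} {lam w : ℝ} (hw : 0 ≤ w) :
    FullyImplements D lam (Measure.dirac w) ↔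
      (wLow D lam ≤ w ∧ lam - D 0 < w ∧ ∀ q ∈ Ico (0:ℝ) 1, w ≠ lam - D q) := by
  unfold FullyImplements wLow
  simp only [eqWorkProb_dirac_iff hw]
  constructor
  · rintro ⟨⟨-, -, h1⟩, h⟩
    refine ⟨?_, ?_, ?_⟩
    · by_contra! hlt
      exact one_ne_zero (h1 (by linarith))
    · by_contra! hle
      exact zero_ne_one (h 0 ⟨by simp, fun h' => by linarith, fun _ => rfl⟩)
    · intro q hq hwq
      exact hq.2.ne (h q ⟨⟨hq.1, hq.2.le⟩, fun h' => by linarith, fun h' => by linarith⟩)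
  · rintro ⟨h1, h0, hne⟩
    refine ⟨⟨by simp, fun _ => trivial, fun h' => by linarith⟩, ?_⟩
    rintro q ⟨hq, hq1, hq0⟩
    by_contra hq_ne
    have hlt : q < 1 := lt_of_le_of_ne hq.2 hq_ne
    rcases lt_trichotomy lam (w + D q) with h | h | h
    · exact hq_ne (hq1 h)
    · exact hne q ⟨hq.1, hlt⟩ (by linarith)
    · rw [hq0 h] at h
      linarith

lemma fullyImplements_dirac_iff_lt {D : ℝ → ℝ} {lam w : ℝ} (hD : ContinuousOn D (Icc 0 1))
    (hw : 0 ≤ w) :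
    FullyImplements D lam (Measure.dirac w) ↔
      lam - w ≤ D 1 ∧ ∀ q ∈ Ico (0:ℝ) 1, lam - w < D q := by
  rw [fullyImplements_dirac_iff hw, wLow]
  constructor
  · rintro ⟨h1, h0, hne⟩
    refine ⟨by linarith, fun q hq => ?_⟩
    by_contra! hle
    obtain ⟨r, hr, hDr⟩ := intermediate_value_Icc' hq.1
      (hD.mono (Icc_subset_Icc_right hq.2.le)) ⟨hle, by linarith⟩
    exact hne r ⟨hr.1, hr.2.trans_lt hq.2⟩ (by linarith)
  · rintro ⟨h1, h⟩
    have h0 := h 0 (by simp)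
    refine ⟨by linarith, by linarith, fun q hq hwq => ?_⟩
    linarith [h q hq]

end Career

open Career in
/-- For `w ≥ 0`, `δ_w` fully implements full working iff `w ≥ w_`,
`w > λ − D(0)`, and `w ≠ λ − D(q)` for every `q ∈ [0,1)`. Moreover,
`inf {w ≥ 0 : δ_w fully implements full working} = w̄`, and the infimum is attained
iff `D(q) > D(1)` for every `q ∈ [0,1)`. -/
theorem statement7 (D : ℝ → ℝ) (lam : ℝ)
    (hD : ContinuousOn D (Icc 0 1))
    (hlam : ∀ q ∈ Icc (0:ℝ) 1, D q < lam) :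
    (∀ w, 0 ≤ w →
      (FullyImplements D lam (Measure.dirac w) ↔
        (wLow D lam ≤ w ∧ lam - D 0 < w ∧ ∀ q ∈ Ico (0:ℝ) 1, w ≠ lam - D q))) ∧
    sInf {w : ℝ | 0 ≤ w ∧ FullyImplements D lam (Measure.dirac w)} = wHigh D lam ∧
    (wHigh D lam ∈ {w : ℝ | 0 ≤ w ∧ FullyImplements D lam (Measure.dirac w)} ↔
      ∀ q ∈ Ico (0:ℝ) 1, D 1 < D q) := by
  obtain ⟨p, hp, hmin⟩ := isCompact_Icc.exists_isMinOn (nonempty_Icc.2 zero_le_one) hD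
  have hle : ∀ q ∈ Icc (0:ℝ) 1, D p ≤ D q := fun q hq => hmin hq
  have hinf : sInf (D '' Icc 0 1) = D p :=
    IsLeast.csInf_eq ⟨mem_image_of_mem D hp, by rintro _ ⟨q, hq, rfl⟩; exact hle q hq⟩
  have hhigh : wHigh D lam = lam - D p := by rw [wHigh, hinf]
  have hpos : 0 < lam - D p := by linarith [hlam p hp]
  have h1mem : (1:ℝ) ∈ Icc (0:ℝ) 1 := by simp
  refine ⟨fun w hw => fullyImplements_dirac_iff hw, ?_, ?_⟩
  · rw [hhigh]
    have himp : ∀ w, lam - D p < w →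
        w ∈ {w : ℝ | 0 ≤ w ∧ FullyImplements D lam (Measure.dirac w)} := by
      intro w hw
      have hw0 : 0 ≤ w := by linarith
      refine ⟨hw0, (fullyImplements_dirac_iff_lt hD hw0).2 ⟨?_, fun q hq => ?_⟩⟩
      · linarith [hle 1 h1mem]
      · linarith [hle q ⟨hq.1, hq.2.le⟩]
    refine csInf_eq_of_forall_ge_of_forall_gt_exists_lt
      ⟨_, himp (lam - D p + 1) (by linarith)⟩ ?_ ?_
    · rintro w ⟨hw0, hw⟩
      obtain ⟨h1, h⟩ := (fullyImplements_dirac_iff_lt hD hw0).1 hw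
      rcases hp.2.eq_or_lt with rfl | hlt
      · linarith
      · linarith [h p ⟨hp.1, hlt⟩]
    · intro b hb
      obtain ⟨w, hw, hwb⟩ := exists_between hb
      exact ⟨w, himp w hw, hwb⟩
  · rw [hhigh, mem_ofPred_eq, fullyImplements_dirac_iff_lt hD hpos.le]
    simp only [sub_sub_cancel]
    constructor
    · rintro ⟨-, -, h⟩
      rcases hp.2.eq_or_lt with rfl | hlt
      · exact h
      · exact absurd (h p ⟨hp.1, hlt⟩) (lt_irrefl _)
    · intro h
      exact ⟨hpos.le, hle 1 h1mem, fun q hq => (hle 1 h1mem).trans_lt (h q hq)⟩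
end
end

section
/- Assume w_ < w̄, let w̃ ∈ (w_, w̄), let q̃ := max{q ∈ [0,1] : w̃ + D(q) = λ}, and let ε > 0. Then the two-point wage policy F̃ := q̃·δ_{w̄+ε} + (1−q̃)·δ_{w̃+ε} fully implements full working; moreover, if ε < (1−q̃)(w̄ − w̃), then the expected wage of F̃, namely q̃(w̄+ε) + (1−q̃)(w̃+ε), is strictly less than w̄. -/
open MeasureTheory Set Filter

noncomputable section

namespace Career

theorem integral_two_point {p : ℝ} (hp : p ∈ Icc (0:ℝ) 1) (a b : ℝ) {σ : ℝ → ℝ}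
    (hσ : Measurable σ) :
    ∫ w, σ w ∂(ENNReal.ofReal p • Measure.dirac a + ENNReal.ofReal (1 - p) • Measure.dirac b) =
      p * σ a + (1 - p) * σ b := by
  have hint (c r : ℝ) : Integrable σ (ENNReal.ofReal r • Measure.dirac c) :=
    (integrable_dirac' hσ.stronglyMeasurable (by simp)).smul_measure ENNReal.ofReal_ne_top
  rw [integral_add_measure (hint a p) (hint b (1 - p)), integral_smul_measure,
    integral_smul_measure, integral_dirac, integral_dirac, ENNReal.toReal_ofReal hp.1,
    ENNReal.toReal_ofReal (sub_nonneg.2 hp.2), smul_eq_mul, smul_eq_mul]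

theorem le_wHigh_add {D : ℝ → ℝ} {lam : ℝ} (hD : ContinuousOn D (Icc 0 1)) {q : ℝ}
    (hq : q ∈ Icc (0:ℝ) 1) : lam ≤ wHigh D lam + D q := by
  have h := csInf_le (isCompact_Icc.image_of_continuousOn hD).bddBelow (mem_image_of_mem D hq)
  unfold wHigh
  linarith

/-- Beyond the largest point where a wage above `wLow` makes the worker indifferent, the worker
weakly prefers to work. -/
theorem le_add_of_isGreatest {D : ℝ → ℝ} {lam w p q : ℝ} (hD : ContinuousOn D (Icc 0 1))
    (hw : wLow D lam < w) (hp : IsGreatest {q | q ∈ Icc (0:ℝ) 1 ∧ w + D q = lam} p)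
    (hq : q ∈ Icc (0:ℝ) 1) (hpq : p ≤ q) : lam ≤ w + D q := by
  by_contra! h
  unfold wLow at hw
  have hsub : Icc q 1 ⊆ Icc 0 1 := Icc_subset_Icc_left hq.1
  obtain ⟨r, hr, hDr⟩ := intermediate_value_Icc hq.2 (hD.mono hsub)
    (show lam - w ∈ Icc (D q) (D 1) from ⟨by linarith, by linarith⟩)
  have hrp : r ≤ p := hp.2 ⟨hsub hr, by linarith⟩
  obtain rfl : r = q := le_antisymm (hrp.trans hpq) hr.1
  linarith

/-- Working exactly at wages at least `wLow` is an equilibrium of any two-point policy whose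
wages are at least `wLow`. -/
theorem eqWorkProb_one_two_point {D : ℝ → ℝ} {lam p a b : ℝ} (hp : p ∈ Icc (0:ℝ) 1)
    (ha : wLow D lam ≤ a) (hb : wLow D lam ≤ b) :
    EqWorkProb D lam
      (ENNReal.ofReal p • Measure.dirac a + ENNReal.ofReal (1 - p) • Measure.dirac b) 1 := by
  have hσ : Measurable ((Ici (wLow D lam)).indicator (1 : ℝ → ℝ)) :=
    measurable_one.indicator measurableSet_Ici
  refine ⟨_, hσ, fun w => ?_, ?_, fun w _ => ⟨fun h => ?_, fun h => ?_⟩⟩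
  · by_cases h : w ∈ Ici (wLow D lam) <;> simp [h]
  · rw [integral_two_point hp a b hσ, indicator_of_mem (mem_Ici.2 ha),
      indicator_of_mem (mem_Ici.2 hb)]
    simp
  · rw [indicator_of_mem (mem_Ici.2 (by unfold wLow; linarith)), Pi.one_apply]
  · exact indicator_of_notMem (notMem_Ici.2 (by unfold wLow; linarith)) _

end Career

open Career in
/-- Assume `w_ < w̄`, `w̃ ∈ (w_, w̄)`, `q̃ = max {q ∈ [0,1] : w̃ + D(q) = λ}`,
and `ε > 0`. The two-point wage policy `F̃ = q̃·δ_{w̄+ε} + (1−q̃)·δ_{w̃+ε}` fully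
implements full working; moreover, if `ε < (1−q̃)(w̄ − w̃)`, then the expected wage
`q̃(w̄+ε) + (1−q̃)(w̃+ε)` is strictly less than `w̄`. -/
theorem statement10 (D : ℝ → ℝ) (lam : ℝ)
    (hD : ContinuousOn D (Icc 0 1))
    (hlam : ∀ q ∈ Icc (0:ℝ) 1, D q < lam)
    (hlt : wLow D lam < wHigh D lam)
    (wt : ℝ) (hwt : wt ∈ Ioo (wLow D lam) (wHigh D lam))
    (qt : ℝ) (hqt : IsGreatest {q | q ∈ Icc (0:ℝ) 1 ∧ wt + D q = lam} qt)
    (ε : ℝ) (hε : 0 < ε) :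
    FullyImplements D lam
      (ENNReal.ofReal qt • Measure.dirac (wHigh D lam + ε) +
        ENNReal.ofReal (1 - qt) • Measure.dirac (wt + ε)) ∧
    (ε < (1 - qt) * (wHigh D lam - wt) →
      qt * (wHigh D lam + ε) + (1 - qt) * (wt + ε) < wHigh D lam) := by
  have hp := hqt.1.1
  obtain ⟨hwl, hwh⟩ := hwt
  have hpos : 0 < wLow D lam := sub_pos.2 (hlam 1 (right_mem_Icc.2 zero_le_one))
  refine ⟨⟨eqWorkProb_one_two_point hp (by linarith) (by linarith), ?_⟩, fun h => by linarith⟩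
  rintro q ⟨σ, hσ, hσ01, hq, hbr⟩
  rw [integral_two_point hp _ _ hσ] at hq
  have hq01 : q ∈ Icc (0:ℝ) 1 := by
    rw [hq]
    exact convex_Icc 0 1 (hσ01 _) (hσ01 _) hp.1 (sub_nonneg.2 hp.2) (add_sub_cancel qt 1)
  have hhigh : σ (wHigh D lam + ε) = 1 :=
    (hbr _ (by linarith)).1 (by linarith [le_wHigh_add (lam := lam) hD hq01])
  have hle : qt ≤ q := by
    rw [hq, hhigh]
    linarith [mul_nonneg (sub_nonneg.2 hp.2) (hσ01 (wt + ε)).1]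
  have hlow : σ (wt + ε) = 1 :=
    (hbr _ (by linarith)).1 (by linarith [le_add_of_isGreatest hD hwl hqt hq01 hle])
  rw [hq, hhigh, hlow]
  ring
end
end

section
/- If v is strictly FOSD-increasing and skill-effort complementarity holds, then D(q) := v(μ̄(q)) − v(μ_(q)) is strictly increasing on [0,1]; in particular D(1) > min_{q∈[0,1]} D(q). -/
open Set Finset

noncomputable section

namespace Monitor

variable {K : ℕ}

/-- Posterior belief on type `k` after observing success, when the market expects
total working probability `q`. -/
def postS (μ0 p0 p : Fin K → ℝ) (q : ℝ) (k : Fin K) : ℝ :=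
  μ0 k * (p0 k + p k * q) / ∑ j, μ0 j * (p0 j + p j * q)

/-- Posterior belief on type `k` after observing failure. -/
def postF (μ0 p0 p : Fin K → ℝ) (q : ℝ) (k : Fin K) : ℝ :=
  μ0 k * (1 - p0 k - p k * q) / ∑ j, μ0 j * (1 - p0 j - p j * q)

/-- Effort effect `P`. -/
def Pvec (μ0 p : Fin K → ℝ) (k : Fin K) : ℝ := μ0 k * p k / ∑ j, μ0 j * p j

/-- Shirking effect on success `Q^S`. -/
def QSvec (μ0 p0 : Fin K → ℝ) (k : Fin K) : ℝ := μ0 k * p0 k / ∑ j, μ0 j * p0 j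

/-- Shirking effect on failure `Q^F`. -/
def QFvec (μ0 p0 : Fin K → ℝ) (k : Fin K) : ℝ :=
  μ0 k * (1 - p0 k) / ∑ j, μ0 j * (1 - p0 j)

/-- A probability vector on `Fin K`. -/
def IsProbVec (μ : Fin K → ℝ) : Prop := (∀ k, 0 ≤ μ k) ∧ ∑ k, μ k = 1

/-- `μ1` strictly first-order stochastically dominates `μ2`. -/
def StrictFOSD (μ1 μ2 : Fin K → ℝ) : Prop :=
  (∀ k, ∑ j ∈ Finset.Iic k, μ1 j ≤ ∑ j ∈ Finset.Iic k, μ2 j) ∧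
  (∃ k, ∑ j ∈ Finset.Iic k, μ1 j < ∑ j ∈ Finset.Iic k, μ2 j)

/-- `v` is strictly increasing in first-order stochastic dominance. -/
def StrictFOSDIncreasing (v : (Fin K → ℝ) → ℝ) : Prop :=
  ∀ μ1 μ2 : Fin K → ℝ, IsProbVec μ1 → IsProbVec μ2 → StrictFOSD μ1 μ2 → v μ2 < v μ1

/-- Skill-effort complementarity: `P` strictly FOSD-dominates both `Q^S` and `Q^F`. -/
def SkillEffortComplementarity (μ0 p0 p : Fin K → ℝ) : Prop :=
  (∀ k, ∑ j ∈ Finset.Iic k, Pvec μ0 p j ≤ ∑ j ∈ Finset.Iic k, QSvec μ0 p0 j) ∧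
  (∀ k, ∑ j ∈ Finset.Iic k, Pvec μ0 p j ≤ ∑ j ∈ Finset.Iic k, QFvec μ0 p0 j) ∧
  ((∃ k, ∑ j ∈ Finset.Iic k, Pvec μ0 p j < ∑ j ∈ Finset.Iic k, QSvec μ0 p0 j) ∨
   (∃ k, ∑ j ∈ Finset.Iic k, Pvec μ0 p j < ∑ j ∈ Finset.Iic k, QFvec μ0 p0 j))

end Monitor

namespace Monitor

/-- A vector on `Fin K` is determined by its cumulative sums. -/
theorem eq_of_sum_Iic_eq {K : ℕ} {f g : Fin K → ℝ}
    (h : ∀ k, ∑ j ∈ Finset.Iic k, f j = ∑ j ∈ Finset.Iic k, g j) : f = g := by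
  funext k
  induction k using WellFoundedLT.induction with
  | ind k ih =>
    have hk := h k
    rw [← Finset.Iio_insert, Finset.sum_insert (by simp), Finset.sum_insert (by simp),
      Finset.sum_congr rfl fun j hj => ih j (Finset.mem_Iio.1 hj)] at hk
    exact add_right_cancel hk

/-- A strictly FOSD-increasing function is weakly increasing in weak dominance. -/
theorem StrictFOSDIncreasing.le_of_sum_Iic_le {K : ℕ} {v : (Fin K → ℝ) → ℝ}
    (hv : StrictFOSDIncreasing v) {μ1 μ2 : Fin K → ℝ} (h1 : IsProbVec μ1) (h2 : IsProbVec μ2)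
    (h : ∀ k, ∑ j ∈ Finset.Iic k, μ1 j ≤ ∑ j ∈ Finset.Iic k, μ2 j) : v μ2 ≤ v μ1 := by
  by_cases hex : ∃ k, ∑ j ∈ Finset.Iic k, μ1 j < ∑ j ∈ Finset.Iic k, μ2 j
  · exact (hv μ1 μ2 h1 h2 ⟨h, hex⟩).le
  · push Not at hex
    rw [eq_of_sum_Iic_eq fun k => le_antisymm (h k) (hex k)]

theorem isProbVec_div_sum {K : ℕ} {w : Fin K → ℝ} (hw : ∀ k, 0 ≤ w k) (hs : 0 < ∑ k, w k) :
    IsProbVec fun k => w k / ∑ j, w j :=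
  ⟨fun k => div_nonneg (hw k) hs.le, by rw [← Finset.sum_div, div_self hs.ne']⟩

theorem add_mul_div_lt_iff {a b A B s t : ℝ} (hs : 0 < A + B * s) (ht : 0 < A + B * t)
    (hst : s < t) :
    (a + b * t) / (A + B * t) < (a + b * s) / (A + B * s) ↔ b * A < a * B := by
  rw [div_lt_div_iff₀ ht hs, ← sub_pos, ← sub_pos (a := a * B),
    show (a + b * s) * (A + B * t) - (a + b * t) * (A + B * s) = (t - s) * (a * B - b * A) by ring]
  exact mul_pos_iff_of_pos_left (sub_pos.2 hst)

theorem add_mul_div_le_iff {a b A B s t : ℝ} (hs : 0 < A + B * s) (ht : 0 < A + B * t)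
    (hst : s < t) :
    (a + b * t) / (A + B * t) ≤ (a + b * s) / (A + B * s) ↔ b * A ≤ a * B := by
  rw [div_le_div_iff₀ ht hs, ← sub_nonneg, ← sub_nonneg (a := a * B),
    show (a + b * s) * (A + B * t) - (a + b * t) * (A + B * s) = (t - s) * (a * B - b * A) by ring]
  exact mul_nonneg_iff_of_pos_left (sub_pos.2 hst)

theorem sum_success_weights {K : ℕ} (μ0 p0 p : Fin K → ℝ) (q : ℝ) (s : Finset (Fin K)) :
    ∑ j ∈ s, μ0 j * (p0 j + p j * q) = ∑ j ∈ s, μ0 j * p0 j + (∑ j ∈ s, μ0 j * p j) * q := by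
  rw [Finset.sum_mul, ← Finset.sum_add_distrib]
  exact Finset.sum_congr rfl fun j _ => by ring

theorem sum_failure_weights {K : ℕ} (μ0 p0 p : Fin K → ℝ) (q : ℝ) (s : Finset (Fin K)) :
    ∑ j ∈ s, μ0 j * (1 - p0 j - p j * q) =
      ∑ j ∈ s, μ0 j * (1 - p0 j) + (∑ j ∈ s, μ0 j * p j) * -q := by
  rw [Finset.sum_mul, ← Finset.sum_add_distrib]
  exact Finset.sum_congr rfl fun j _ => by ring

theorem strictMonoOn_postS_sub_postF {K : ℕ} (hK : 0 < K) {μ0 p0 p : Fin K → ℝ}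
    (hμpos : ∀ k, 0 < μ0 k) (hμsum : ∑ k, μ0 k = 1)
    (hp0_nonneg : ∀ k, 0 ≤ p0 k) (hp_pos : ∀ k, 0 < p k)
    (hsum_le : ∀ k, p0 k + p k ≤ 1)
    (hS : 0 < ∑ k, μ0 k * p0 k)
    (hF : ∑ k, μ0 k * (p0 k + p k) < 1)
    {v : (Fin K → ℝ) → ℝ} (hv : StrictFOSDIncreasing v)
    (hsec : SkillEffortComplementarity μ0 p0 p) :
    StrictMonoOn (fun q => v (postS μ0 p0 p q) - v (postF μ0 p0 p q)) (Icc 0 1) := by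
  have : NeZero K := ⟨hK.ne'⟩
  have hB : 0 < ∑ k, μ0 k * p k :=
    Finset.sum_pos (fun k _ => mul_pos (hμpos k) (hp_pos k)) Finset.univ_nonempty
  have hAB : ∑ k, μ0 k * p k < ∑ k, μ0 k * (1 - p0 k) := by
    simp only [mul_add, mul_sub, mul_one, Finset.sum_add_distrib, Finset.sum_sub_distrib] at hF ⊢
    linarith
  have hA : 0 < ∑ k, μ0 k * (1 - p0 k) := hB.trans hAB
  have posS : ∀ q ∈ Icc (0 : ℝ) 1, 0 < ∑ k, μ0 k * p0 k + (∑ k, μ0 k * p k) * q :=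
    fun q hq => add_pos_of_pos_of_nonneg hS (mul_nonneg hB.le hq.1)
  have posF : ∀ q ∈ Icc (0 : ℝ) 1, 0 < ∑ k, μ0 k * (1 - p0 k) + (∑ k, μ0 k * p k) * -q :=
    fun q hq => by nlinarith [hq.2]
  have probS : ∀ q ∈ Icc (0 : ℝ) 1, IsProbVec (postS μ0 p0 p q) := fun q hq =>
    isProbVec_div_sum
      (fun k => mul_nonneg (hμpos k).le
        (add_nonneg (hp0_nonneg k) (mul_nonneg (hp_pos k).le hq.1)))
      (by rw [sum_success_weights]; exact posS q hq)
  have probF : ∀ q ∈ Icc (0 : ℝ) 1, IsProbVec (postF μ0 p0 p q) := fun q hq =>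
    isProbVec_div_sum
      (fun k => mul_nonneg (hμpos k).le (by nlinarith [hq.2, hp_pos k, hsum_le k]))
      (by rw [sum_failure_weights]; exact posF q hq)
  intro s hs t ht hst
  simp only [sub_eq_add_neg]
  obtain ⟨hPS, hPF, hstrict⟩ := hsec
  simp only [Pvec, QSvec, QFvec, ← Finset.sum_div, div_le_div_iff₀ hB hS, div_le_div_iff₀ hB hA,
    div_lt_div_iff₀ hB hS, div_lt_div_iff₀ hB hA] at hPS hPF hstrict
  have leS : ∀ k, ∑ j ∈ Finset.Iic k, postS μ0 p0 p t j ≤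
      ∑ j ∈ Finset.Iic k, postS μ0 p0 p s j := fun k => by
    simp only [postS, ← Finset.sum_div, sum_success_weights]
    exact (add_mul_div_le_iff (posS s hs) (posS t ht) hst).2 (hPS k)
  have leF : ∀ k, ∑ j ∈ Finset.Iic k, postF μ0 p0 p s j ≤
      ∑ j ∈ Finset.Iic k, postF μ0 p0 p t j := fun k => by
    simp only [postF, ← Finset.sum_div, sum_failure_weights]
    exact (add_mul_div_le_iff (posF t ht) (posF s hs) (neg_lt_neg hst)).2 (hPF k)
  rcases hstrict with ⟨k, hk⟩ | ⟨k, hk⟩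
  · refine add_lt_add_of_lt_of_le (hv _ _ (probS t ht) (probS s hs) ⟨leS, k, ?_⟩)
      (neg_le_neg (hv.le_of_sum_Iic_le (probF s hs) (probF t ht) leF))
    simp only [postS, ← Finset.sum_div, sum_success_weights]
    exact (add_mul_div_lt_iff (posS s hs) (posS t ht) hst).2 hk
  · refine add_lt_add_of_le_of_lt (hv.le_of_sum_Iic_le (probS t ht) (probS s hs) leS)
      (neg_lt_neg (hv _ _ (probF s hs) (probF t ht) ⟨leF, k, ?_⟩))
    simp only [postF, ← Finset.sum_div, sum_failure_weights]
    exact (add_mul_div_lt_iff (posF t ht) (posF s hs) (neg_lt_neg hst)).2 hk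

end Monitor

open Monitor in
/-- If `v` is strictly FOSD-increasing and skill-effort complementarity
holds, then `D(q) = v(μ̄(q)) − v(μ_(q))` is strictly increasing on `[0,1]`;
in particular `D(1) > min_{q ∈ [0,1]} D(q)`. -/
theorem statement11 (K : ℕ) (hK : 2 ≤ K)
    (μ0 p0 p : Fin K → ℝ)
    (hμpos : ∀ k, 0 < μ0 k) (hμsum : ∑ k, μ0 k = 1)
    (hp0_nonneg : ∀ k, 0 ≤ p0 k) (hp_pos : ∀ k, 0 < p k)
    (hsum_le : ∀ k, p0 k + p k ≤ 1)
    (hS : 0 < ∑ k, μ0 k * p0 k)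
    (hF : ∑ k, μ0 k * (p0 k + p k) < 1)
    (v : (Fin K → ℝ) → ℝ)
    (hv : StrictFOSDIncreasing v)
    (hsec : SkillEffortComplementarity μ0 p0 p) :
    StrictMonoOn (fun q => v (postS μ0 p0 p q) - v (postF μ0 p0 p q)) (Icc 0 1) ∧
    sInf ((fun q => v (postS μ0 p0 p q) - v (postF μ0 p0 p q)) '' Icc 0 1) <
      v (postS μ0 p0 p 1) - v (postF μ0 p0 p 1) := by
  have hmono := strictMonoOn_postS_sub_postF (by lia) hμpos hμsum hp0_nonneg hp_pos hsum_le
    hS hF hv hsec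
  have h0 : (0 : ℝ) ∈ Icc (0 : ℝ) 1 := left_mem_Icc.2 zero_le_one
  have h1 : (1 : ℝ) ∈ Icc (0 : ℝ) 1 := right_mem_Icc.2 zero_le_one
  refine ⟨hmono, ?_⟩
  rw [(hmono.monotoneOn.map_isLeast (isLeast_Icc zero_le_one)).csInf_eq]
  exact hmono h0 h1 zero_lt_one
end
end

section
/- For every k ∈ Θ: (i) the map q ↦ Σ_{j≤k} μ̄ⱼ(q) is nonincreasing on [0,1] if and only if Σ_{j≤k} Pⱼ ≤ Σ_{j≤k} Q^Sⱼ, and it is strictly decreasing on [0,1] if and only if Σ_{j≤k} Pⱼ < Σ_{j≤k} Q^Sⱼ; (ii) the map q ↦ Σ_{j≤k} μ_ⱼ(q) is nondecreasing on [0,1] if and only if Σ_{j≤k} Pⱼ ≤ Σ_{j≤k} Q^Fⱼ, and it is strictly increasing on [0,1] if and only if Σ_{j≤k} Pⱼ < Σ_{j≤k} Q^Fⱼ. -/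
open Set Finset

noncomputable section

namespace Monitor

/-- For an affine fraction with positive denominators, the values at `x < y` are ordered
according to the sign of its determinant. -/
theorem div_affine_lt_div_affine_iff {A B C D x y : ℝ} (hxy : x < y)
    (hx : 0 < C + D * x) (hy : 0 < C + D * y) :
    (A + B * x) / (C + D * x) < (A + B * y) / (C + D * y) ↔ A * D < B * C := by
  rw [div_lt_div_iff₀ hx hy, ← sub_pos, ← sub_pos (a := B * C),
    show (A + B * y) * (C + D * x) - (A + B * x) * (C + D * y) =
      (y - x) * (B * C - A * D) by ring]
  exact mul_pos_iff_of_pos_left (sub_pos.2 hxy)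

theorem affine_pos_of_mem_Icc {C D x : ℝ} (hC : 0 < C) (hCD : 0 < C + D)
    (hx : x ∈ Icc (0 : ℝ) 1) : 0 < C + D * x := by
  obtain ⟨h0, h1⟩ := hx
  rcases h0.eq_or_lt with rfl | h0
  · simpa using hC
  · nlinarith [mul_pos hCD h0, mul_nonneg hC.le (sub_nonneg.2 h1)]

theorem strictMonoOn_div_affine_iff {A B C D : ℝ} (hC : 0 < C) (hCD : 0 < C + D) :
    StrictMonoOn (fun q : ℝ => (A + B * q) / (C + D * q)) (Icc 0 1) ↔ A * D < B * C := by
  have key : ∀ x ∈ Icc (0 : ℝ) 1, ∀ y ∈ Icc (0 : ℝ) 1, x < y →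
      ((A + B * x) / (C + D * x) < (A + B * y) / (C + D * y) ↔ A * D < B * C) :=
    fun x hx y hy hxy => div_affine_lt_div_affine_iff hxy
      (affine_pos_of_mem_Icc hC hCD hx) (affine_pos_of_mem_Icc hC hCD hy)
  exact ⟨fun h => (key 0 (by simp) 1 (by simp) one_pos).1 (h (by simp) (by simp) one_pos),
    fun h x hx y hy hxy => (key x hx y hy hxy).2 h⟩

theorem strictAntiOn_div_affine_iff {A B C D : ℝ} (hC : 0 < C) (hCD : 0 < C + D) :
    StrictAntiOn (fun q : ℝ => (A + B * q) / (C + D * q)) (Icc 0 1) ↔ B * C < A * D := by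
  have h := strictMonoOn_div_affine_iff (A := -A) (B := -B) hC hCD
  rw [neg_mul, neg_mul, neg_lt_neg_iff] at h
  rw [← h]
  simp only [StrictMonoOn, StrictAntiOn, neg_mul, ← neg_add, neg_div, neg_lt_neg_iff]

theorem antitoneOn_div_affine_iff {A B C D : ℝ} (hC : 0 < C) (hCD : 0 < C + D) :
    AntitoneOn (fun q : ℝ => (A + B * q) / (C + D * q)) (Icc 0 1) ↔ B * C ≤ A * D := by
  have key : ∀ x ∈ Icc (0 : ℝ) 1, ∀ y ∈ Icc (0 : ℝ) 1, x < y →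
      ((A + B * y) / (C + D * y) ≤ (A + B * x) / (C + D * x) ↔ B * C ≤ A * D) :=
    fun x hx y hy hxy => le_iff_le_iff_lt_iff_lt.2 (div_affine_lt_div_affine_iff hxy
      (affine_pos_of_mem_Icc hC hCD hx) (affine_pos_of_mem_Icc hC hCD hy))
  refine ⟨fun h => (key 0 (by simp) 1 (by simp) one_pos).1
    (h (by simp) (by simp) zero_le_one), fun h x hx y hy hxy => ?_⟩
  rcases hxy.eq_or_lt with rfl | hxy
  · exact le_rfl
  · exact (key x hx y hy hxy).2 h

theorem monotoneOn_div_affine_iff {A B C D : ℝ} (hC : 0 < C) (hCD : 0 < C + D) :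
    MonotoneOn (fun q : ℝ => (A + B * q) / (C + D * q)) (Icc 0 1) ↔ A * D ≤ B * C := by
  have h := antitoneOn_div_affine_iff (A := -A) (B := -B) hC hCD
  rw [neg_mul, neg_mul, neg_le_neg_iff] at h
  rw [← h]
  simp only [AntitoneOn, MonotoneOn, neg_mul, ← neg_add, neg_div, neg_le_neg_iff]

theorem sum_postS_eq_div_affine {K : ℕ} (μ0 p0 p : Fin K → ℝ) (s : Finset (Fin K)) (q : ℝ) :
    ∑ j ∈ s, postS μ0 p0 p q j =
      (∑ j ∈ s, μ0 j * p0 j + (∑ j ∈ s, μ0 j * p j) * q) /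
        (∑ j, μ0 j * p0 j + (∑ j, μ0 j * p j) * q) := by
  simp only [postS, ← Finset.sum_div, Finset.sum_mul, ← Finset.sum_add_distrib, mul_add, mul_assoc]

theorem sum_postF_eq_div_affine {K : ℕ} (μ0 p0 p : Fin K → ℝ) (s : Finset (Fin K)) (q : ℝ) :
    ∑ j ∈ s, postF μ0 p0 p q j =
      (∑ j ∈ s, μ0 j * (1 - p0 j) + (-∑ j ∈ s, μ0 j * p j) * q) /
        (∑ j, μ0 j * (1 - p0 j) + (-∑ j, μ0 j * p j) * q) := by
  simp only [postF, ← Finset.sum_div, neg_mul, Finset.sum_mul, ← sub_eq_add_neg,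
    ← Finset.sum_sub_distrib, mul_sub, mul_assoc]

end Monitor

open Monitor in
/-- For every `k`: the lower tail of the success-posterior is
nonincreasing (resp. strictly decreasing) in `q` iff `Σ_{j≤k} Pⱼ ≤ Σ_{j≤k} Q^Sⱼ`
(resp. `<`), and the lower tail of the failure-posterior is nondecreasing
(resp. strictly increasing) in `q` iff `Σ_{j≤k} Pⱼ ≤ Σ_{j≤k} Q^Fⱼ` (resp. `<`). -/
theorem statement12 (K : ℕ) (hK : 2 ≤ K)
    (μ0 p0 p : Fin K → ℝ)
    (hμpos : ∀ k, 0 < μ0 k) (hμsum : ∑ k, μ0 k = 1)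
    (hp0_nonneg : ∀ k, 0 ≤ p0 k) (hp_pos : ∀ k, 0 < p k)
    (hsum_le : ∀ k, p0 k + p k ≤ 1)
    (hS : 0 < ∑ k, μ0 k * p0 k)
    (hF : ∑ k, μ0 k * (p0 k + p k) < 1) :
    ∀ k : Fin K,
      (AntitoneOn (fun q => ∑ j ∈ Finset.Iic k, postS μ0 p0 p q j) (Icc 0 1) ↔
        ∑ j ∈ Finset.Iic k, Pvec μ0 p j ≤ ∑ j ∈ Finset.Iic k, QSvec μ0 p0 j) ∧
      (StrictAntiOn (fun q => ∑ j ∈ Finset.Iic k, postS μ0 p0 p q j) (Icc 0 1) ↔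
        ∑ j ∈ Finset.Iic k, Pvec μ0 p j < ∑ j ∈ Finset.Iic k, QSvec μ0 p0 j) ∧
      (MonotoneOn (fun q => ∑ j ∈ Finset.Iic k, postF μ0 p0 p q j) (Icc 0 1) ↔
        ∑ j ∈ Finset.Iic k, Pvec μ0 p j ≤ ∑ j ∈ Finset.Iic k, QFvec μ0 p0 j) ∧
      (StrictMonoOn (fun q => ∑ j ∈ Finset.Iic k, postF μ0 p0 p q j) (Icc 0 1) ↔
        ∑ j ∈ Finset.Iic k, Pvec μ0 p j < ∑ j ∈ Finset.Iic k, QFvec μ0 p0 j) := by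
  intro k
  have hD : 0 < ∑ j, μ0 j * p j :=
    Finset.sum_pos (fun j _ => mul_pos (hμpos j) (hp_pos j)) ⟨k, Finset.mem_univ k⟩
  have hCD : 0 < ∑ j, μ0 j * (1 - p0 j) + -∑ j, μ0 j * p j := by
    simp only [mul_add, Finset.sum_add_distrib] at hF
    simp only [mul_sub, mul_one, Finset.sum_sub_distrib, hμsum]
    linarith
  have hC : 0 < ∑ j, μ0 j * (1 - p0 j) := by linarith
  simp only [sum_postS_eq_div_affine, sum_postF_eq_div_affine, Pvec, QSvec, QFvec,
    ← Finset.sum_div]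
  refine ⟨?_, ?_, ?_, ?_⟩
  · rw [antitoneOn_div_affine_iff hS (by positivity), div_le_div_iff₀ hD hS]
  · rw [strictAntiOn_div_affine_iff hS (by positivity), div_lt_div_iff₀ hD hS]
  · rw [monotoneOn_div_affine_iff hC hCD, div_le_div_iff₀ hD hC, mul_neg, neg_mul,
      neg_le_neg_iff]
  · rw [strictMonoOn_div_affine_iff hC hCD, div_lt_div_iff₀ hD hC, mul_neg, neg_mul,
      neg_lt_neg_iff]
end
end

section
/- For every q ∈ [0,1], D(q) = Cov(u,p) · q / ((p₀ + E₀[p]·q)(1 − p₀ − E₀[p]·q)). -/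
open Set Finset

noncomputable section

namespace LinearEnv

variable {Θ : Type*} [Fintype Θ]

/-- Expectation under the prior. -/
def E0 (μ0 x : Θ → ℝ) : ℝ := ∑ k, μ0 k * x k

/-- Covariance under the prior. -/
def Cov (μ0 u p : Θ → ℝ) : ℝ := E0 μ0 (fun k => u k * p k) - E0 μ0 u * E0 μ0 p

/-- Posterior on type `k` after success in the linear environment. -/
def postS (μ0 : Θ → ℝ) (p0 : ℝ) (p : Θ → ℝ) (q : ℝ) (k : Θ) : ℝ :=
  μ0 k * (p0 + p k * q) / ∑ j, μ0 j * (p0 + p j * q)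

/-- Posterior on type `k` after failure in the linear environment. -/
def postF (μ0 : Θ → ℝ) (p0 : ℝ) (p : Θ → ℝ) (q : ℝ) (k : Θ) : ℝ :=
  μ0 k * (1 - p0 - p k * q) / ∑ j, μ0 j * (1 - p0 - p j * q)

/-- The career-value function in the linear environment. -/
def D (μ0 : Θ → ℝ) (p0 : ℝ) (p u : Θ → ℝ) (q : ℝ) : ℝ :=
  (∑ k, u k * postS μ0 p0 p q k) - ∑ k, u k * postF μ0 p0 p q k

end LinearEnv

namespace LinearEnv

variable {Θ : Type*} [Fintype Θ]

lemma sum_mul_affine (μ0 p : Θ → ℝ) (a b : ℝ) :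
    ∑ k, μ0 k * (a + p k * b) = (∑ k, μ0 k) * a + E0 μ0 p * b := by
  simp only [E0, Finset.sum_mul, ← Finset.sum_add_distrib]
  exact Finset.sum_congr rfl fun k _ => by ring

lemma sum_mul_postS (μ0 p u : Θ → ℝ) (hμsum : ∑ k, μ0 k = 1) (p0 q : ℝ) :
    ∑ k, u k * postS μ0 p0 p q k =
      (p0 * E0 μ0 u + q * E0 μ0 (fun k => u k * p k)) / (p0 + E0 μ0 p * q) := by
  simp only [postS, sum_mul_affine, hμsum, one_mul]
  simp only [E0, Finset.mul_sum, ← Finset.sum_add_distrib, Finset.sum_div]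
  exact Finset.sum_congr rfl fun k _ => by ring

lemma postF_eq_postS (μ0 p : Θ → ℝ) (p0 q : ℝ) (k : Θ) :
    postF μ0 p0 p q k = postS μ0 (1 - p0) p (-q) k := by
  simp only [postF, postS, mul_neg, sub_eq_add_neg]

end LinearEnv

open LinearEnv in
/-- In the linear environment, for every `q ∈ [0,1]`,
`D(q) = Cov(u,p) · q / ((p₀ + E₀[p]q)(1 − p₀ − E₀[p]q))`. -/
theorem statement13 {Θ : Type*} [Fintype Θ]
    (μ0 : Θ → ℝ) (hμpos : ∀ k, 0 < μ0 k) (hμsum : ∑ k, μ0 k = 1)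
    (p0 : ℝ) (hp0 : p0 ∈ Ioo (0:ℝ) 1)
    (p : Θ → ℝ) (hp_pos : ∀ k, 0 < p k) (hsum_le : ∀ k, p0 + p k ≤ 1)
    (hF : ∑ k, μ0 k * (p0 + p k) < 1)
    (u : Θ → ℝ) :
    ∀ q ∈ Icc (0:ℝ) 1,
      D μ0 p0 p u q =
        Cov μ0 u p * q / ((p0 + E0 μ0 p * q) * (1 - p0 - E0 μ0 p * q)) := by
  rintro q ⟨hq0, hq1⟩
  have hE : 0 ≤ E0 μ0 p :=
    Finset.sum_nonneg fun k _ => (mul_pos (hμpos k) (hp_pos k)).le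
  have hlt : p0 + E0 μ0 p < 1 := by
    have h := sum_mul_affine μ0 p p0 1
    simp only [mul_one, hμsum, one_mul] at h
    linarith
  have hS : p0 + E0 μ0 p * q ≠ 0 :=
    (add_pos_of_pos_of_nonneg hp0.1 (mul_nonneg hE hq0)).ne'
  have hF' : 1 - p0 - E0 μ0 p * q ≠ 0 := by
    have h := mul_le_of_le_one_right hE hq1
    exact (by linarith : 0 < 1 - p0 - E0 μ0 p * q).ne'
  simp only [D, postF_eq_postS, sum_mul_postS _ _ _ hμsum, mul_neg, ← sub_eq_add_neg]
  rw [div_sub_div _ _ hS hF']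
  congr 1
  simp only [Cov]
  ring
end
end

section
/- D(1) > min_{q∈[0,1]} D(q) if and only if Cov(u,p) > 0. -/
open Set Finset

noncomputable section

namespace LinearEnv

variable {Θ : Type*} [Fintype Θ]

/-- The career value is the covariance times the effort-only factor `q / s + q / (1 - s)`, where
`s = p₀ + q E₀[p]` is the success probability. -/
theorem D_eq_cov_mul (μ0 : Θ → ℝ) (hμsum : ∑ k, μ0 k = 1) (p0 : ℝ) (p u : Θ → ℝ) (q : ℝ)
    (hS : p0 + E0 μ0 p * q ≠ 0) (hF : 1 - p0 - E0 μ0 p * q ≠ 0) :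
    D μ0 p0 p u q =
      Cov μ0 u p * (q / (p0 + E0 μ0 p * q) + q / (1 - p0 - E0 μ0 p * q)) := by
  have hlin (a b : ℝ) : ∑ k, μ0 k * (a + p k * b) = a + E0 μ0 p * b := by
    simp only [mul_add, ← mul_assoc, sum_add_distrib, ← sum_mul, hμsum, one_mul, E0]
  have hlin' (a b : ℝ) : ∑ k, u k * (μ0 k * (a + p k * b)) =
      E0 μ0 u * a + E0 μ0 (fun k => u k * p k) * b := by
    simp only [E0, sum_mul, ← sum_add_distrib]
    exact sum_congr rfl fun k _ => by ring
  have hsub (k : Θ) : 1 - p0 - p k * q = (1 - p0) + p k * (-q) := by ring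
  have hsub' : 1 - p0 + E0 μ0 p * (-q) = 1 - p0 - E0 μ0 p * q := by ring
  simp only [D, postS, postF, ← mul_div_assoc, ← sum_div, hsub, hlin, hlin', hsub', Cov]
  rw [div_sub_div _ _ hS hF, div_add_div _ _ hS hF, mul_div_assoc']
  congr 1
  ring

/-- The effort-only factor of the career value is increasing in effort. -/
theorem effort_factor_le {p0 m q : ℝ} (hp0 : 0 < p0) (hm : 0 ≤ m) (hF : p0 + m < 1)
    (hq : q ∈ Icc (0 : ℝ) 1) :
    q / (p0 + m * q) + q / (1 - p0 - m * q) ≤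
      1 / (p0 + m * 1) + 1 / (1 - p0 - m * 1) := by
  obtain ⟨hq0, hq1⟩ := hq
  have hmq : m * q ≤ m := mul_le_of_le_one_right hm hq1
  have hmq0 : 0 ≤ m * q := mul_nonneg hm hq0
  refine add_le_add ?_ ?_
  · rw [div_le_div_iff₀ (by linarith) (by linarith)]
    nlinarith
  · exact div_le_div₀ zero_le_one hq1 (by linarith) (by linarith)

end LinearEnv

open LinearEnv in
/-- In the linear environment, `D(1) > min_{q ∈ [0,1]} D(q)` if and
only if `Cov(u,p) > 0`. -/
theorem statement14 {Θ : Type*} [Fintype Θ]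
    (μ0 : Θ → ℝ) (hμpos : ∀ k, 0 < μ0 k) (hμsum : ∑ k, μ0 k = 1)
    (p0 : ℝ) (hp0 : p0 ∈ Ioo (0:ℝ) 1)
    (p : Θ → ℝ) (hp_pos : ∀ k, 0 < p k) (hsum_le : ∀ k, p0 + p k ≤ 1)
    (hF : ∑ k, μ0 k * (p0 + p k) < 1)
    (u : Θ → ℝ) :
    sInf (D μ0 p0 p u '' Icc 0 1) < D μ0 p0 p u 1 ↔ 0 < Cov μ0 u p := by
  have hm : 0 ≤ E0 μ0 p := sum_nonneg fun k _ => (mul_pos (hμpos k) (hp_pos k)).le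
  have hm1 : p0 + E0 μ0 p < 1 := by
    simpa only [mul_add, sum_add_distrib, ← sum_mul, hμsum, one_mul, E0] using hF
  have hp0' : 0 < p0 := hp0.1
  have hpos {q : ℝ} (hq : q ∈ Icc (0 : ℝ) 1) :
      0 < p0 + E0 μ0 p * q ∧ 0 < 1 - p0 - E0 μ0 p * q := by
    have h₁ : E0 μ0 p * q ≤ E0 μ0 p := mul_le_of_le_one_right hm hq.2
    have h₀ : 0 ≤ E0 μ0 p * q := mul_nonneg hm hq.1
    constructor <;> linarith
  have hD {q : ℝ} (hq : q ∈ Icc (0 : ℝ) 1) :=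
    D_eq_cov_mul μ0 hμsum p0 p u q (hpos hq).1.ne' (hpos hq).2.ne'
  have zero_mem : (0 : ℝ) ∈ Icc (0 : ℝ) 1 := left_mem_Icc.2 zero_le_one
  have one_mem : (1 : ℝ) ∈ Icc (0 : ℝ) 1 := right_mem_Icc.2 zero_le_one
  constructor
  · contrapose!
    intro hC
    refine le_csInf ⟨_, mem_image_of_mem _ one_mem⟩ ?_
    rintro _ ⟨q, hq, rfl⟩
    rw [hD hq, hD one_mem]
    exact mul_le_mul_of_nonpos_left (effort_factor_le hp0' hm hm1 hq) hC
  · intro hC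
    refine csInf_lt_of_lt ⟨0, ?_⟩ (mem_image_of_mem _ zero_mem) ?_
    · rintro _ ⟨q, hq, rfl⟩
      obtain ⟨hS, hF'⟩ := hpos hq
      rw [hD hq]
      have hq0 : 0 ≤ q := hq.1
      positivity
    · obtain ⟨hS, hF'⟩ := hpos one_mem
      rw [hD zero_mem, hD one_mem, zero_div, zero_div, add_zero, mul_zero]
      positivity
end
end

section
/- Let Θ be a finite set, μ⁰ ∈ ℝ^Θ a probability vector with μ⁰ₖ > 0 for all k, and u¹, u², p : Θ → ℝ with Σₖ μ⁰ₖ u¹ₖ = Σₖ μ⁰ₖ u²ₖ. Suppose there exists k* ∈ Θ such that u²ₖ > u¹ₖ for every k with pₖ > p_{k*} and u²ₖ < u¹ₖ for every k with pₖ < p_{k*}, and suppose pₖ ≠ p_{k*} for some k ∈ Θ. Then Σₖ μ⁰ₖ u²ₖ pₖ > Σₖ μ⁰ₖ u¹ₖ pₖ; equivalently Cov(u²,p) > Cov(u¹,p), where Cov(u,p) := Σₖ μ⁰ₖ uₖ pₖ − (Σₖ μ⁰ₖ uₖ)(Σₖ μ⁰ₖ pₖ). -/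
open Finset

/-- single-crossing of market values implies a strict covariance
ranking. If `u²` single-crosses `u¹` from below relative to `p` at `k*`, the prior
means of `u¹` and `u²` coincide, and `p` is not constant at `p_{k*}`, then
`Σ μ⁰ₖ u²ₖ pₖ > Σ μ⁰ₖ u¹ₖ pₖ`; equivalently `Cov(u²,p) > Cov(u¹,p)`. -/
theorem statement15 {Θ : Type*} [Fintype Θ]
    (μ0 : Θ → ℝ) (hμpos : ∀ k, 0 < μ0 k) (hμsum : ∑ k, μ0 k = 1)
    (u1 u2 p : Θ → ℝ)
    (hmean : ∑ k, μ0 k * u1 k = ∑ k, μ0 k * u2 k)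
    (kstar : Θ)
    (habove : ∀ k, p kstar < p k → u1 k < u2 k)
    (hbelow : ∀ k, p k < p kstar → u2 k < u1 k)
    (hnontriv : ∃ k, p k ≠ p kstar) :
    (∑ k, μ0 k * u1 k * p k < ∑ k, μ0 k * u2 k * p k) ∧
    ((∑ k, μ0 k * (u1 k * p k)) - (∑ k, μ0 k * u1 k) * (∑ k, μ0 k * p k) <
      (∑ k, μ0 k * (u2 k * p k)) - (∑ k, μ0 k * u2 k) * (∑ k, μ0 k * p k)) := by
  have hpos : ∀ k, p k ≠ p kstar → 0 < μ0 k * ((u2 k - u1 k) * (p k - p kstar)) := by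
    intro k hk
    refine mul_pos (hμpos k) ?_
    rcases lt_or_gt_of_ne hk with h | h
    · exact mul_pos_of_neg_of_neg (sub_neg.2 (hbelow k h)) (sub_neg.2 h)
    · exact mul_pos (sub_pos.2 (habove k h)) (sub_pos.2 h)
  have hsum : 0 < ∑ k, μ0 k * ((u2 k - u1 k) * (p k - p kstar)) := by
    obtain ⟨k, hk⟩ := hnontriv
    refine Finset.sum_pos' (fun j _ => ?_) ⟨k, Finset.mem_univ k, hpos k hk⟩
    by_cases hj : p j = p kstar
    · simp [hj]
    · exact (hpos j hj).le
  have hexpand : ∑ k, μ0 k * ((u2 k - u1 k) * (p k - p kstar)) =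
      (∑ k, μ0 k * u2 k * p k - ∑ k, μ0 k * u1 k * p k) -
        (∑ k, μ0 k * u2 k - ∑ k, μ0 k * u1 k) * p kstar := by
    rw [← Finset.sum_sub_distrib, ← Finset.sum_sub_distrib, Finset.sum_mul,
      ← Finset.sum_sub_distrib]
    exact Finset.sum_congr rfl fun k _ => by ring
  have hlt : ∑ k, μ0 k * u1 k * p k < ∑ k, μ0 k * u2 k * p k := by
    rw [hexpand, hmean] at hsum
    linarith
  refine ⟨hlt, ?_⟩
  simp only [← mul_assoc]
  rw [hmean]
  exact sub_lt_sub_right hlt _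
end

section
/- Assume w̃ > w̰, and suppose R^G is a tail wage policy for which there exists w_l with 0 < w_l < w̃ such that: R^G(w) = 1 for all w ∈ [0, w_l], R^G(w) = 0 for all w ≥ w̃, R^G is continuous and strictly decreasing on [w_l, w̃], and w + D(R^G(w+λ₀), R^G(w)) = λ_H for all w ∈ [w_l, w̃]. Define R†(w) := 1 for w ≤ w̰ and R†(w) := R^G(w) for w > w̰, and call a tail wage policy R feasible if R(w) = 1 for all w ≤ w̰ and w-EB′ holds for all w ≥ w̰ − λ₀. Then R† is feasible, every feasible R satisfies R(w) ≥ R†(w) for all w ≥ 0, and R† is the unique minimizer of ∫_{w̰}^∞ R(s) ds over all feasible tail wage policies. -/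
open MeasureTheory Set Filter

noncomputable section

namespace Informed

/-- A tail wage policy: nonincreasing, left-continuous `R : [0,∞) → [0,1]` with
`R(0) = 1` (modelled as a function on `ℝ`, constrained on `[0,∞)`). -/
def IsTailPolicy (R : ℝ → ℝ) : Prop :=
  R 0 = 1 ∧ (∀ w, 0 ≤ w → R w ∈ Icc (0:ℝ) 1) ∧ AntitoneOn R (Ici 0) ∧
    ∀ w, 0 < w → Tendsto R (nhdsWithin w (Iio w)) (nhds (R w))

/-- The support of a tail wage policy: wages `w ≥ 0` around which `R` strictly
decreases, i.e. `R(max(w−ε,0)) > R(w+ε)` for every `ε > 0`. -/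
def suppTail (R : ℝ → ℝ) : Set ℝ :=
  {w | 0 ≤ w ∧ ∀ ε > 0, R (w + ε) < R (max (w - ε) 0)}

/-- The constraint `w`-EB′: `w + D(R(w+λ₀), R(w)) ≥ λ_H`. -/
def EB' (D : ℝ → ℝ → ℝ) (lamH lam0 : ℝ) (R : ℝ → ℝ) (w : ℝ) : Prop :=
  lamH ≤ w + D (R (w + lam0)) (R w)

/-- `w`-EB′ binds: `w + D(R(w+λ₀), R(w)) = λ_H`. -/
def EB'Binds (D : ℝ → ℝ → ℝ) (lamH lam0 : ℝ) (R : ℝ → ℝ) (w : ℝ) : Prop :=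
  w + D (R (w + lam0)) (R w) = lamH

/-- A greedy tail wage policy: `w`-EB′ holds whenever `R(w) < 1`, and `w`-EB′ binds
exactly on the support of `R`. -/
def Greedy (D : ℝ → ℝ → ℝ) (lamH lam0 : ℝ) (R : ℝ → ℝ) : Prop :=
  (∀ w, 0 ≤ w → R w < 1 → EB' D lamH lam0 R w) ∧
  (∀ w, 0 ≤ w → (EB'Binds D lamH lam0 R w ↔ w ∈ suppTail R))

end Informed

namespace Informed

/-- Two left-continuous functions that agree almost everywhere on `(a, ∞)` agree at every
point of `(a, ∞)`. -/
lemma eq_of_ae_eq_Ioi_of_tendsto_left {f g : ℝ → ℝ} {a w : ℝ} (haw : a < w)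
    (hfg : f =ᵐ[volume.restrict (Ioi a)] g)
    (hf : Tendsto f (nhdsWithin w (Iio w)) (nhds (f w)))
    (hg : Tendsto g (nhdsWithin w (Iio w)) (nhds (g w))) : f w = g w := by
  have hfreq : ∃ᶠ x in nhdsWithin w (Iio w), f x - g x ∈ ({0} : Set ℝ) := by
    intro hev
    obtain ⟨l, hl, hsub⟩ := (mem_nhdsLT_iff_exists_Ioo_subset' haw).1 hev
    have hae := (ae_restrict_iff' measurableSet_Ioi).1 hfg
    have hnull : volume (Ioo (max a l) w) = 0 := by
      refine measure_mono_null (fun x hx => ?_) (ae_iff.1 hae)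
      have hx1 := max_lt_iff.1 hx.1
      intro h
      exact hsub ⟨hx1.2, hx.2⟩ (sub_eq_zero.2 (h hx1.1))
    rw [Real.volume_Ioo, ENNReal.ofReal_eq_zero] at hnull
    have := max_lt haw hl
    linarith
  exact sub_eq_zero.1 (isClosed_singleton.mem_of_frequently_of_tendsto hfreq (hf.sub hg))

lemma IsTailPolicy.ite {R : ℝ → ℝ} (hR : IsTailPolicy R) {a : ℝ} (ha : 0 ≤ a) :
    IsTailPolicy (fun w => if w ≤ a then 1 else R w) := by
  obtain ⟨-, hmem, hanti, hleft⟩ := hR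
  refine ⟨by simp [ha], fun w hw => ?_, fun x hx y hy hxy => ?_, fun w hw => ?_⟩
  · dsimp only
    split_ifs
    · simp
    · exact hmem w hw
  · dsimp only
    split_ifs with h1 h2 h2
    · exact le_rfl
    · linarith
    · exact (hmem y hy).2
    · exact hanti hx hy hxy
  · dsimp only
    by_cases h : w ≤ a
    · rw [if_pos h]
      refine tendsto_const_nhds.congr' ?_
      filter_upwards [self_mem_nhdsWithin] with x hx
      rw [if_pos (le_trans (le_of_lt hx) h)]
    · rw [if_neg h]
      refine (hleft w hw).congr' ?_
      filter_upwards [nhdsWithin_le_nhds (Ioi_mem_nhds (not_le.1 h))] with x hx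
      rw [if_neg (not_le.2 hx)]

/-- Backward induction in steps of length `lam0`: a policy satisfying EB′ dominates one for
which EB′ binds, provided the latter vanishes from `whi` on. -/
lemma le_of_EB'Binds_of_EB' {D : ℝ → ℝ → ℝ} {lamH lam0 a whi : ℝ} {S R : ℝ → ℝ}
    (hDanti : ∀ y ∈ Icc (0:ℝ) 1, AntitoneOn (fun x => D x y) (Icc (0:ℝ) 1))
    (hDmono : ∀ x ∈ Icc (0:ℝ) 1, StrictMonoOn (fun y => D x y) (Icc (0:ℝ) 1))
    (hlam0 : 0 < lam0)
    (hS : ∀ w, a ≤ w → S w ∈ Icc (0:ℝ) 1) (hR : ∀ w, a ≤ w → R w ∈ Icc (0:ℝ) 1)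
    (hS0 : ∀ w, whi ≤ w → S w = 0)
    (hbind : ∀ w, a ≤ w → w ≤ whi → EB'Binds D lamH lam0 S w)
    (hEB : ∀ w, a ≤ w → EB' D lamH lam0 R w) {w : ℝ} (hw : a ≤ w) : S w ≤ R w := by
  have key : ∀ n : ℕ, ∀ w, a ≤ w → whi ≤ w + n * lam0 → S w ≤ R w := by
    intro n
    induction n with
    | zero =>
      intro w hw h
      rw [hS0 w (by simpa using h)]
      exact (hR w hw).1
    | succ n ih =>
      intro w hw h
      rcases le_total whi w with h' | h'
      · rw [hS0 w h']
        exact (hR w hw).1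
      · have hw' : a ≤ w + lam0 := by linarith
        have hstep := ih (w + lam0) hw' (by push_cast at h; linarith)
        have h1 : w + D (S (w + lam0)) (S w) = lamH := hbind w hw h'
        have h2 : lamH ≤ w + D (R (w + lam0)) (R w) := hEB w hw
        have h3 : D (R (w + lam0)) (S w) ≤ D (S (w + lam0)) (S w) :=
          hDanti _ (hS w hw) (hS _ hw') (hR _ hw') hstep
        refine ((hDmono _ (hR _ hw')).le_iff_le (hS w hw) (hR w hw)).1 ?_
        change D (R (w + lam0)) (S w) ≤ D (R (w + lam0)) (R w)
        linarith
  obtain ⟨n, hn⟩ := exists_nat_ge ((whi - w) / lam0)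
  rw [div_le_iff₀ hlam0] at hn
  exact key n w hw (by linarith)

/-- The tail integral of a tail wage policy that vanishes from some point on is finite. -/
lemma IsTailPolicy.lintegral_Ioi_ne_top {R : ℝ → ℝ} (hR : IsTailPolicy R) {a b : ℝ}
    (ha : 0 ≤ a) (hb : ∀ w, b < w → R w = 0) :
    ∫⁻ w in Ioi a, ENNReal.ofReal (R w) ≠ ⊤ := by
  have hle : ∫⁻ w in Ioi a, ENNReal.ofReal (R w) ≤
      ∫⁻ w in Ioi a, (Iic b).indicator 1 w := by
    refine setLIntegral_mono' measurableSet_Ioi fun w hw => ?_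
    by_cases h : w ≤ b
    · rw [indicator_of_mem (mem_Iic.2 h), Pi.one_apply, ENNReal.ofReal_le_one]
      exact (hR.2.1 w (ha.trans (le_of_lt hw))).2
    · simp [hb w (not_le.1 h)]
  refine ne_top_of_le_ne_top ?_ hle
  rw [lintegral_indicator_one measurableSet_Iic, Measure.restrict_apply measurableSet_Iic,
    inter_comm, Ioi_inter_Iic, Real.volume_Ioc]
  exact ENNReal.ofReal_ne_top

lemma IsTailPolicy.aemeasurable_Ioi {R : ℝ → ℝ} (hR : IsTailPolicy R) {a : ℝ} (ha : 0 ≤ a) :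
    AEMeasurable R (volume.restrict (Ioi a)) :=
  aemeasurable_restrict_of_antitoneOn measurableSet_Ioi
    (hR.2.2.1.mono fun _ hx => ha.trans (le_of_lt hx))

end Informed

open Informed in
/-- Given a tail wage policy `R^G` that equals `1` up to `w_l`, is
continuous and strictly decreasing on `[w_l, w̃]` with binding EB′ there, and `0`
beyond `w̃`, the policy `R†` (equal to `1` up to `w̰` and to `R^G` thereafter) is
feasible, is a pointwise lower bound for every feasible tail wage policy, and is
the unique minimizer of `∫_{w̰}^∞ R(s) ds` among feasible tail wage policies. -/
theorem statement17 (D : ℝ → ℝ → ℝ) (lamH lamL : ℝ)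
    (hDcont : ContinuousOn (fun x : ℝ × ℝ => D x.1 x.2) (Icc 0 1 ×ˢ Icc 0 1))
    (hDanti : ∀ y ∈ Icc (0:ℝ) 1, StrictAntiOn (fun x => D x y) (Icc (0:ℝ) 1))
    (hDmono : ∀ x ∈ Icc (0:ℝ) 1, StrictMonoOn (fun y => D x y) (Icc (0:ℝ) 1))
    (hlam : lamH < lamL)
    (hbound : ∀ x ∈ Icc (0:ℝ) 1, ∀ y ∈ Icc (0:ℝ) 1, D x y < lamH)
    (lam0 wlo whi : ℝ)
    (hlam0 : lam0 = lamL - lamH)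
    (hwlo : wlo = lamL - D 1 1) (hwhi : whi = lamH - D 0 0)
    (hlt : wlo < whi)
    (RG : ℝ → ℝ) (hRG : IsTailPolicy RG)
    (wl : ℝ) (hwl0 : 0 < wl) (hwlwhi : wl < whi)
    (hRG1 : ∀ w ∈ Icc (0:ℝ) wl, RG w = 1)
    (hRG0 : ∀ w, whi ≤ w → RG w = 0)
    (hRGcont : ContinuousOn RG (Icc wl whi))
    (hRGanti : StrictAntiOn RG (Icc wl whi))
    (hRGbind : ∀ w ∈ Icc wl whi, EB'Binds D lamH lam0 RG w)
    (Rdag : ℝ → ℝ) (hRdag : Rdag = fun w => if w ≤ wlo then 1 else RG w)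
    (Feasible : (ℝ → ℝ) → Prop)
    (hFeasible : Feasible = fun R => IsTailPolicy R ∧
      (∀ w, 0 ≤ w → w ≤ wlo → R w = 1) ∧
      ∀ w, wlo - lam0 ≤ w → EB' D lamH lam0 R w) :
    Feasible Rdag ∧
    (∀ R, Feasible R → ∀ w, 0 ≤ w → Rdag w ≤ R w) ∧
    (∀ R, Feasible R →
      (∫⁻ w in Ioi wlo, ENNReal.ofReal (Rdag w)) ≤
        ∫⁻ w in Ioi wlo, ENNReal.ofReal (R w)) ∧
    (∀ R, Feasible R →
      (∫⁻ w in Ioi wlo, ENNReal.ofReal (R w)) =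
        (∫⁻ w in Ioi wlo, ENNReal.ofReal (Rdag w)) →
      ∀ w, 0 ≤ w → R w = Rdag w) := by
  have hone : (1:ℝ) ∈ Icc (0:ℝ) 1 := by simp
  have hD11 := hbound 1 hone 1 hone
  have hlam0_pos : 0 < lam0 := by linarith
  have hwlo_sub : wlo - lam0 = lamH - D 1 1 := by rw [hwlo, hlam0]; ring
  have hwlo_pos : 0 < wlo := by linarith
  have hRdag_tail : IsTailPolicy Rdag := hRdag ▸ hRG.ite hwlo_pos.le
  have hRdag_of_le : ∀ w, w ≤ wlo → Rdag w = 1 := fun w hw => by simp [hRdag, hw]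
  have hRdag_of_lt : ∀ w, wlo < w → Rdag w = RG w := fun w hw => by
    simp [hRdag, not_le.2 hw]
  have hD1 : ∀ x ∈ Icc (0:ℝ) 1, D 1 1 ≤ D x 1 := fun x hx =>
    (hDanti 1 hone).antitoneOn hx hone hx.2
  have hEBdag : ∀ w, wlo - lam0 ≤ w → EB' D lamH lam0 Rdag w := by
    intro w hw
    have hw0 : 0 ≤ w := by linarith
    have hsat : Rdag w = 1 → EB' D lamH lam0 Rdag w := fun h => by
      have := hD1 _ (hRdag_tail.2.1 (w + lam0) (by linarith))
      unfold EB'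
      rw [h]
      linarith
    rcases le_or_gt w wlo with h | h
    · exact hsat (hRdag_of_le w h)
    rcases le_total w wl with h' | h'
    · exact hsat (by rw [hRdag_of_lt w h, hRG1 w ⟨hw0, h'⟩])
    unfold EB'
    rw [hRdag_of_lt w h, hRdag_of_lt (w + lam0) (by linarith)]
    rcases le_total w whi with h'' | h''
    · exact (hRGbind w ⟨h', h''⟩).ge
    · rw [hRG0 w h'', hRG0 (w + lam0) (by linarith)]
      linarith
  have hlower : ∀ R, Feasible R → ∀ w, 0 ≤ w → Rdag w ≤ R w := by
    intro R hR w hw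
    rw [hFeasible] at hR
    obtain ⟨hRt, hR1, hREB⟩ := hR
    have hdom : ∀ v, max wlo wl ≤ v → RG v ≤ R v := by
      have hnn : ∀ v, max wlo wl ≤ v → 0 ≤ v := fun v hv =>
        hwl0.le.trans ((le_max_right _ _).trans hv)
      intro v hv
      refine le_of_EB'Binds_of_EB' (fun y hy => (hDanti y hy).antitoneOn) hDmono hlam0_pos
        (fun u hu => hRG.2.1 u (hnn u hu)) (fun u hu => hRt.2.1 u (hnn u hu)) hRG0
        (fun u hu hu' => hRGbind u ⟨(le_max_right _ _).trans hu, hu'⟩)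
        (fun u hu => hREB u ?_) hv
      have := (le_max_left _ _).trans hu
      linarith
    rcases le_or_gt w wlo with h | h
    · rw [hRdag_of_le w h, hR1 w hw h]
    rw [hRdag_of_lt w h]
    rcases le_total wl w with h' | h'
    · exact hdom w (max_le h.le h')
    · calc RG w = 1 := hRG1 w ⟨hw, h'⟩
        _ = RG wl := (hRG1 wl ⟨hwl0.le, le_rfl⟩).symm
        _ ≤ R wl := hdom wl (max_le (h.le.trans h') le_rfl)
        _ ≤ R w := hRt.2.2.1 hw hwl0.le h'
  refine ⟨?_, hlower, fun R hR => ?_, fun R hR hint w hw => ?_⟩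
  · rw [hFeasible]
    exact ⟨hRdag_tail, fun w _ h => hRdag_of_le w h, hEBdag⟩
  · exact setLIntegral_mono' measurableSet_Ioi fun w hw =>
      ENNReal.ofReal_le_ofReal (hlower R hR w (hwlo_pos.le.trans (le_of_lt hw)))
  · have hle := hlower R hR
    rw [hFeasible] at hR
    obtain ⟨hRt, hR1, -⟩ := hR
    rcases le_or_gt w wlo with h | h
    · rw [hRdag_of_le w h, hR1 w hw h]
    have hw_pos : 0 < w := hwlo_pos.trans h
    have hfin := hRdag_tail.lintegral_Ioi_ne_top hwlo_pos.le (b := whi) fun v hv => by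
      rw [hRdag_of_lt v (hlt.trans hv), hRG0 v hv.le]
    have hae := ae_eq_of_ae_le_of_lintegral_le
      (ae_restrict_of_forall_mem measurableSet_Ioi fun v hv =>
        ENNReal.ofReal_le_ofReal (hle v (hwlo_pos.le.trans (le_of_lt hv))))
      hfin (hRt.aemeasurable_Ioi hwlo_pos.le).ennreal_ofReal hint.le
    refine eq_of_ae_eq_Ioi_of_tendsto_left h ?_ (hRt.2.2.2 w hw_pos)
      (hRdag_tail.2.2.2 w hw_pos)
    filter_upwards [hae, ae_restrict_mem measurableSet_Ioi] with v hv hmem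
    have hv0 : 0 ≤ v := hwlo_pos.le.trans (le_of_lt hmem)
    exact ((ENNReal.ofReal_eq_ofReal_iff (hRdag_tail.2.1 v hv0).1 (hRt.2.1 v hv0).1).1 hv).symm
end
end

section
/- Let K ≥ 2, let λ₁ > λ₂ > … > λ_K be reals, and let D : [0,1]^K → ℝ be continuous and, for each coordinate k (with the other coordinates held fixed at any values), quasi-concave as a function of the k-th coordinate on [0,1]. For k ∈ {1,…,K} and q ∈ [0,1], let Q_{k,q} ∈ [0,1]^K be the vector whose j-th coordinate is 0 for j < k, q for j = k, and 1 for j > k, and set W^m := {λ_k − D(Q_{k,q}) : 1 ≤ k ≤ K, q ∈ [0,1]}. Then W^m has a maximum, and max W^m = max{ max_{1≤k≤K} (λ_k − D(Q_{k,0})), λ₁ − D(Q_{1,1}) }, where Q_{1,1} = (1,…,1) and Q_{k,0} is the vector with exactly k leading zeros followed by ones. -/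
open Set

noncomputable section

/-- On an interval, a quasiconcave function is bounded below by the smaller of its endpoint values. -/
theorem QuasiconcaveOn.min_endpoints_le {f : ℝ → ℝ} {a b t : ℝ}
    (hf : QuasiconcaveOn ℝ (Icc a b) f) (ht : t ∈ Icc a b) : min (f a) (f b) ≤ f t := by
  have hab : a ≤ b := ht.1.trans ht.2
  exact ((hf (min (f a) (f b))).ordConnected.out ⟨left_mem_Icc.2 hab, min_le_left _ _⟩
    ⟨right_mem_Icc.2 hab, min_le_right _ _⟩ ht).2

/-- with `λ₁ > … > λ_K`, `D` continuous on the cube and quasi-concave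
in each coordinate, and `Q_{k,q}` the threshold working-probability profiles, the set
`W^m = {λ_k − D(Q_{k,q})}` has a maximum, equal to
`max{ max_k (λ_k − D(Q_{k,0})), λ₁ − D(Q_{1,1}) }`. -/
theorem statement19 (K : ℕ) (hK : 2 ≤ K)
    (lam : Fin K → ℝ) (hlam : StrictAnti lam)
    (D : (Fin K → ℝ) → ℝ)
    (hDcont : ContinuousOn D (Set.pi Set.univ fun _ => Icc (0:ℝ) 1))
    (hDqc : ∀ (k : Fin K) (Q : Fin K → ℝ), (∀ j, Q j ∈ Icc (0:ℝ) 1) →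
      QuasiconcaveOn ℝ (Icc (0:ℝ) 1) (fun t => D (Function.update Q k t)))
    (Qvec : Fin K → ℝ → Fin K → ℝ)
    (hQvec : ∀ (k : Fin K) (q : ℝ) (j : Fin K),
      Qvec k q j = if j < k then 0 else if j = k then q else 1)
    (Wm : Set ℝ)
    (hWm : Wm = {x | ∃ k : Fin K, ∃ q ∈ Icc (0:ℝ) 1, x = lam k - D (Qvec k q)})
    (k0 : Fin K) (hk0 : k0 = ⟨0, by omega⟩) :
    IsGreatest Wm
      (max (sSup (Set.range fun k : Fin K => lam k - D (Qvec k 0)))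
        (lam k0 - D (Qvec k0 1))) := by
  have hzero : (0 : ℝ) ∈ Icc (0 : ℝ) 1 := ⟨le_rfl, zero_le_one⟩
  have hone : (1 : ℝ) ∈ Icc (0 : ℝ) 1 := ⟨zero_le_one, le_rfl⟩
  have hupdate : ∀ k q, Function.update (Qvec k 0) k q = Qvec k q := by
    intro k q
    ext j
    by_cases hj : j = k
    · subst hj
      simp [hQvec]
    · simp [hQvec, hj]
  have hcube : ∀ k j, Qvec k 0 j ∈ Icc (0 : ℝ) 1 := by
    intro k j
    rw [hQvec]
    split_ifs <;> assumption
  have hmin : ∀ k, ∀ q ∈ Icc (0 : ℝ) 1,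
      min (D (Qvec k 0)) (D (Qvec k 1)) ≤ D (Qvec k q) := by
    intro k q hq
    simpa only [hupdate] using (hDqc k _ (hcube k)).min_endpoints_le hq
  have hfin : (range fun k : Fin K => lam k - D (Qvec k 0)).Finite := finite_range _
  have hzero_le : ∀ k, lam k - D (Qvec k 0) ≤
      sSup (range fun k : Fin K => lam k - D (Qvec k 0)) :=
    fun k => le_csSup hfin.bddAbove (mem_range_self k)
  have hone_le : ∀ k, lam k - D (Qvec k 1) ≤
      max (sSup (range fun k : Fin K => lam k - D (Qvec k 0))) (lam k0 - D (Qvec k0 1)) := by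
    intro k
    by_cases hk : k = k0
    · rw [hk]
      exact le_max_right _ _
    · have hpos : 0 < k.val := by
        rw [hk0, Fin.ext_iff] at hk
        exact Nat.pos_of_ne_zero hk
      let k' : Fin K := ⟨k.val - 1, by omega⟩
      have hlt : k' < k := Fin.lt_def.2 (Nat.sub_lt hpos one_pos)
      have hQ : Qvec k 1 = Qvec k' 0 := by
        ext j
        simp only [hQvec, Fin.lt_def, Fin.ext_iff, k']
        split_ifs <;> first | rfl | omega
      rw [hQ]
      exact (sub_le_sub_right (hlam hlt).le _).trans ((hzero_le k').trans (le_max_left _ _))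
  subst hWm
  constructor
  · rcases max_choice (sSup (range fun k : Fin K => lam k - D (Qvec k 0)))
      (lam k0 - D (Qvec k0 1)) with h | h
    · rw [h]
      obtain ⟨k, hk⟩ := Set.Nonempty.csSup_mem ⟨_, mem_range_self k0⟩ hfin
      exact ⟨k, 0, hzero, hk.symm⟩
    · rw [h]
      exact ⟨k0, 1, hone, rfl⟩
  · rintro x ⟨k, q, hq, rfl⟩
    rcases min_le_iff.1 (hmin k q hq) with h | h
    · exact (sub_le_sub_left h _).trans ((hzero_le k).trans (le_max_left _ _))
    · exact (sub_le_sub_left h _).trans (hone_le k)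
end
end
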